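/- Let D be an irreducible deformation space. If any one of the following conditions is satisfied, then D is non-ascending: (1) no reduced graph of groups in D contains a strict ascending loop; (2) there exists a tree T ∈ D such that no fixed point set Fix(g), for g ≠ 1, contains an infinite ray; (3) no group in A_min properly contains a conjugate of itself; (4) there exists T_c ∈ D such that for every T ∈ D there exists T̃ ∈ D from which both T_c and T may be obtained by collapses. -/

import Mathlib

set_option autoImplicit false
set_option maxHeartbeats 1000000
open scoped Classical

universe u

section Trees

variable (G : Type u) [Group G]

/-- A (minimal, simplicial) `G`-tree: a simplicial tree together with an action of `G` by
simplicial automorphisms, without inversions, admitting no proper invariant subtree. -/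
structure GTree : Type (u + 1) where
  V : Type u
  nonempty : Nonempty V
  graph : SimpleGraph V
  isTree : graph.IsTree
  act : G →* Equiv.Perm V
  adj_act : ∀ (g : G) (u v : V), graph.Adj u v → graph.Adj (act g u) (act g v)
  noInversion : ∀ (g : G) (u v : V), graph.Adj u v → ¬(act g u = v ∧ act g v = u)
  minimal : ∀ S : Set V, S.Nonempty → (∀ (g : G), ∀ v ∈ S, act g v ∈ S) →
      (∀ u ∈ S, ∀ v ∈ S, ∀ p : graph.Walk u v, p.IsPath → ∀ w ∈ p.support, w ∈ S) →
      S = Set.univ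

variable {G}

namespace GTree

variable (T : GTree G)

/-- The stabilizer of a vertex. -/
def stab (v : T.V) : Subgroup G where
  carrier := {g : G | T.act g v = v}
  one_mem' := by simp
  mul_mem' := by
    intro a b ha hb
    simp only [Set.mem_setOf_eq, map_mul, Equiv.Perm.mul_apply] at *
    rw [hb, ha]
  inv_mem' := by
    intro a ha
    simp only [Set.mem_setOf_eq] at *
    have h : T.act a⁻¹ (T.act a v) = v := by
      rw [← Equiv.Perm.mul_apply, ← map_mul, inv_mul_cancel, map_one, Equiv.Perm.one_apply]
    rwa [ha] at h

/-- The (pointwise) stabilizer of an edge `uv`; since the action has no inversions this is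
the full stabilizer of the edge. -/
def edgeStab (u v : T.V) : Subgroup G := T.stab u ⊓ T.stab v

/-- A subgroup of `G` is elliptic if it fixes a vertex. -/
def Elliptic (H : Subgroup G) : Prop := ∃ v : T.V, ∀ h ∈ H, T.act h v = v

/-- An element of `G` is elliptic if it fixes a vertex. -/
def EllipticElt (g : G) : Prop := ∃ v : T.V, T.act g v = v

/-- An element of `G` is hyperbolic if it fixes no vertex. -/
def Hyperbolic (g : G) : Prop := ∀ v : T.V, T.act g v ≠ v

/-- A `G`-tree is reduced if whenever the stabilizer of an edge `uv` equals the stabilizer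
of `u` (i.e. `G_u ≤ G_v`), the two endpoints are in the same orbit. -/
def Reduced : Prop :=
  ∀ u v : T.V, T.graph.Adj u v → T.stab u ≤ T.stab v → ∃ g : G, T.act g u = v

/-- `T` is a single point. -/
protected def Trivial : Prop := ∀ u v : T.V, u = v

/-- `T` is a (simplicial) line. -/
def IsLine : Prop := ∀ v : T.V, ∃ a b : T.V, a ≠ b ∧ {w : T.V | T.graph.Adj v w} = {a, b}

/-- `G` fixes an end of `T`: there is an equivariant choice, for each vertex, of the next
vertex in the direction of the fixed end. -/
def FixesEnd : Prop :=
  ∃ next : T.V → T.V, (∀ v, T.graph.Adj v (next v)) ∧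
    (∀ (g : G) (v : T.V), next (T.act g v) = T.act g (next v)) ∧
    (∀ v, next (next v) ≠ v)

/-- Linear abelian type: `T` is a line on which `G` acts by translations (every element acts
either trivially or freely). -/
def LinearAbelian : Prop :=
  T.IsLine ∧ ∀ g : G, (∀ v : T.V, T.act g v = v) ∨ (∀ v : T.V, T.act g v ≠ v)

/-- Dihedral type: `T` is a line and some element acts as a reflection. -/
def Dihedral : Prop :=
  T.IsLine ∧ ∃ g : G, (∃ v : T.V, T.act g v = v) ∧ (∃ w : T.V, T.act g w ≠ w)

/-- Genuine abelian type: `G` fixes an end and `T` is not a line. -/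
def GenuineAbelian : Prop := T.FixesEnd ∧ ¬T.IsLine

/-- Irreducibility, via the characterization by hyperbolicity of a commutator. -/
def Irred : Prop :=
  ∃ g h : G, T.Hyperbolic g ∧ T.Hyperbolic h ∧ T.Hyperbolic (g * h * g⁻¹ * h⁻¹)

/-- The image of a dart (oriented edge) under the action of `g`. -/
def dartAct (g : G) (d : T.graph.Dart) : T.graph.Dart :=
  ⟨(T.act g d.toProd.1, T.act g d.toProd.2), T.adj_act g d.toProd.1 d.toProd.2 d.adj⟩

/-- Three oriented edges are aligned (in this order) if some geodesic crosses them
successively, with the correct orientations. -/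
def Aligned (d₁ d₂ d₃ : T.graph.Dart) : Prop :=
  ∃ (u v : T.V) (p : T.graph.Walk u v), p.IsPath ∧ [d₁, d₂, d₃].Sublist p.darts

end GTree

/-- Two `G`-trees lie in the same deformation space iff they have the same elliptic
subgroups. -/
def SameDef (T T' : GTree G) : Prop := ∀ H : Subgroup G, T.Elliptic H ↔ T'.Elliptic H

/-- An equivariant isomorphism of simplicial `G`-trees. -/
def SimpIso (T T' : GTree G) : Prop :=
  ∃ e : T.V ≃ T'.V, (∀ (g : G) (v : T.V), e (T.act g v) = T'.act g (e v)) ∧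
    ∀ u v : T.V, T.graph.Adj u v ↔ T'.graph.Adj (e u) (e v)

end Trees
section Collapses

variable {G : Type u} [Group G]

/-- Two ordered pairs of adjacent vertices span edges in the same `G`-orbit
(as non-oriented edges). -/
def InEdgeOrbit (T : GTree G) (a b c d : T.V) : Prop :=
  ∃ g : G, (T.act g a = c ∧ T.act g b = d) ∨ (T.act g a = d ∧ T.act g b = c)

/-- `c` exhibits `T'` as a (possibly non-elementary) collapse of `T`: it is equivariant,
surjective, sends non-collapsed edges to edges, is onto the edges of `T'`, and its point
preimages are subtrees. -/
def IsCollapseMap (T T' : GTree G) (c : T.V → T'.V) : Prop :=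
  (∀ (g : G) (v : T.V), c (T.act g v) = T'.act g (c v)) ∧
  Function.Surjective c ∧
  (∀ u v : T.V, T.graph.Adj u v → c u ≠ c v → T'.graph.Adj (c u) (c v)) ∧
  (∀ u' v' : T'.V, T'.graph.Adj u' v' → ∃ u v : T.V, T.graph.Adj u v ∧ c u = u' ∧ c v = v') ∧
  (∀ u v : T.V, c u = c v → ∀ p : T.graph.Walk u v, p.IsPath → ∀ w ∈ p.support, c w = c u)

/-- `T'` is obtained from `T` by a (possibly non-elementary) collapse. -/
def CollapseOf (T' T : GTree G) : Prop := ∃ c : T.V → T'.V, IsCollapseMap T T' c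

/-- `T'` is obtained from `T` by collapsing (exactly) all the edges in the orbit of a
single edge. -/
def IsOrbitCollapse (T' T : GTree G) : Prop :=
  ∃ (c : T.V → T'.V) (u₀ v₀ : T.V), T.graph.Adj u₀ v₀ ∧ IsCollapseMap T T' c ∧
    ∀ u v : T.V, T.graph.Adj u v → (c u = c v ↔ InEdgeOrbit T u v u₀ v₀)

/-- An elementary collapse: collapsing the orbit of a collapsible edge, i.e. an orbit
collapse staying in the same deformation space. -/
def ElemCollapse (T T' : GTree G) : Prop := IsOrbitCollapse T' T ∧ SameDef T T'

/-- An elementary move: an elementary collapse or an elementary expansion. -/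
def ElemMove (T T' : GTree G) : Prop := ElemCollapse T T' ∨ ElemCollapse T' T

/-- An elementary deformation: a finite sequence of elementary collapses and expansions. -/
def ElemDeformation (T T' : GTree G) : Prop := Relation.ReflTransGen ElemMove T T'

/-- A slide move: an edge `f = vx` with `G_f ≤ G_e` slides across `e = vw` (and
equivariantly so does its orbit), becoming an edge `f' = wx`. -/
def SlideMove (T T' : GTree G) : Prop :=
  ∃ (e : T.V ≃ T'.V) (v w x : T.V),
    T.graph.Adj v w ∧ T.graph.Adj v x ∧ w ≠ x ∧
    T.edgeStab v x ≤ T.edgeStab v w ∧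
    ¬InEdgeOrbit T v w v x ∧
    (∀ (g : G) (u : T.V), e (T.act g u) = T'.act g (e u)) ∧
    (∀ a b : T.V, T'.graph.Adj (e a) (e b) ↔
      ((T.graph.Adj a b ∧ ¬InEdgeOrbit T a b v x) ∨ InEdgeOrbit T a b w x))

end Collapses

section MetricTrees

variable (G : Type u) [Group G]

/-- A metric `G`-tree: a simplicial `G`-tree together with an equivariant assignment of
positive lengths to the edges. -/
structure MGTree extends GTree G : Type (u + 1) where
  len : V → V → ℝ
  len_symm : ∀ u v : V, len u v = len v u
  len_pos : ∀ u v : V, graph.Adj u v → 0 < len u v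
  len_equivariant : ∀ (g : G) (u v : V), len (act g u) (act g v) = len u v

variable {G}

namespace MGTree

variable (T : MGTree G)

/-- The length of a walk. -/
noncomputable def walkLen {u v : T.V} (p : T.graph.Walk u v) : ℝ :=
  (p.darts.map fun d => T.len d.toProd.1 d.toProd.2).sum

/-- The distance between two vertices: the length of the unique reduced path joining them. -/
noncomputable def dist (u v : T.V) : ℝ :=
  sInf {x : ℝ | ∃ p : T.graph.Walk u v, p.IsPath ∧ x = T.walkLen p}

/-- The translation length of `g`. -/
noncomputable def ell (g : G) : ℝ :=
  sInf {x : ℝ | ∃ v : T.V, x = T.dist v (T.act g v)}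

/-- The axis (or characteristic set) of `g`: the set of points moved exactly `ℓ(g)`. -/
def Axis (g : G) : Set T.V := {v : T.V | T.dist v (T.act g v) = T.ell g}

/-- `T` is abelian: its length function is the absolute value of a homomorphism to `ℝ`
with cyclic image. -/
def IsAbelian : Prop :=
  ∃ φ : G → ℝ, (∀ g h : G, φ (g * h) = φ g + φ h) ∧
    (∃ a : ℝ, ∀ g : G, ∃ n : ℤ, φ g = (n : ℝ) * a) ∧
    ∀ g : G, T.ell g = |φ g|

/-- Irreducibility for metric trees: two hyperbolic elements with disjoint axes. -/
def Irr : Prop :=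
  ∃ g h : G, T.toGTree.Hyperbolic g ∧ T.toGTree.Hyperbolic h ∧ T.Axis g ∩ T.Axis h = ∅

end MGTree

/-- An equivariant simplicial isomorphism multiplying all edge lengths by `c`. -/
def EquivHomothety (c : ℝ) (T T' : MGTree G) : Prop :=
  ∃ e : T.V ≃ T'.V, (∀ (g : G) (v : T.V), e (T.act g v) = T'.act g (e v)) ∧
    (∀ u v : T.V, T.graph.Adj u v ↔ T'.graph.Adj (e u) (e v)) ∧
    ∀ u v : T.V, T.graph.Adj u v → T'.len (e u) (e v) = c * T.len u v

/-- An equivariant isometry of metric `G`-trees. -/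
def EquivIsometric (T T' : MGTree G) : Prop := EquivHomothety 1 T T'

/-- The action of an automorphism of `G` on metric `G`-trees, by precomposition. -/
def MGTree.precomp (φ : MulAut G) (T : MGTree G) : MGTree G where
  V := T.V
  nonempty := T.nonempty
  graph := T.graph
  isTree := T.isTree
  act := T.act.comp φ.toMonoidHom
  adj_act := fun g u v h => T.adj_act (φ g) u v h
  noInversion := fun g u v h => T.noInversion (φ g) u v h
  minimal := fun S h1 h2 h3 => T.minimal S h1
    (fun g v hv => by simpa using h2 (φ.symm g) v hv) h3
  len := T.len
  len_symm := T.len_symm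
  len_pos := T.len_pos
  len_equivariant := fun g u v => T.len_equivariant (φ g) u v

end MetricTrees
section Topologies

variable (G : Type u) [Group G]

/-- Basic Gromov–Hausdorff neighbourhood of the metric `G`-tree `T` determined by finite
sets `X ⊆ T`, `A ⊆ G` and `ε > 0`: the trees admitting an `ε`-approximate equivariant
lift of `X`. -/
def gromovBasic (T : MGTree G) (X : Finset T.V) (A : Finset G) (ε : ℝ) : Set (MGTree G) :=
  {T' : MGTree G | ∃ f : T.V → T'.V, ∀ x ∈ X, ∀ y ∈ X, ∀ g ∈ A,
    |T.dist x (T.act g y) - T'.dist (f x) (T'.act g (f y))| < ε}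

/-- The equivariant Gromov–Hausdorff topology on the space of metric `G`-trees. -/
noncomputable def gromovTop : TopologicalSpace (MGTree G) where
  IsOpen U := ∀ T ∈ U, ∃ (X : Finset T.V) (A : Finset G) (ε : ℝ), 0 < ε ∧
    gromovBasic G T X A ε ⊆ U
  isOpen_univ := fun T _ => ⟨∅, ∅, 1, one_pos, Set.subset_univ _⟩
  isOpen_inter := by
    intro U V hU hV T hT
    obtain ⟨X₁, A₁, ε₁, hε₁, h₁⟩ := hU T hT.1
    obtain ⟨X₂, A₂, ε₂, hε₂, h₂⟩ := hV T hT.2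
    refine ⟨X₁ ∪ X₂, A₁ ∪ A₂, min ε₁ ε₂, lt_min hε₁ hε₂, ?_⟩
    intro T' hT'
    obtain ⟨f, hf⟩ := hT'
    constructor
    · exact h₁ ⟨f, fun x hx y hy g hg =>
        lt_of_lt_of_le (hf x (Finset.mem_union_left _ hx) y (Finset.mem_union_left _ hy) g
          (Finset.mem_union_left _ hg)) (min_le_left _ _)⟩
    · exact h₂ ⟨f, fun x hx y hy g hg =>
        lt_of_lt_of_le (hf x (Finset.mem_union_right _ hx) y (Finset.mem_union_right _ hy) g
          (Finset.mem_union_right _ hg)) (min_le_right _ _)⟩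
  isOpen_sUnion := by
    intro s hs T hT
    obtain ⟨U, hUs, hTU⟩ := hT
    obtain ⟨X, A, ε, hε, h⟩ := hs U hUs T hTU
    exact ⟨X, A, ε, hε, h.trans (Set.subset_sUnion_of_mem hUs)⟩

variable {G}

/-- The closed cone of the (restricted) deformation space `D` spanned by `T`: the trees
of `D` obtained from trees having the same underlying simplicial tree as `T` by
(elementary) collapses. -/
def closedCone (D : Set (MGTree G)) (T : MGTree G) : Set (MGTree G) :=
  {T' : MGTree G | T' ∈ D ∧ CollapseOf T'.toGTree T.toGTree}

/-- The open cone containing `T`: the trees with the same underlying simplicial tree. -/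
def openCone (D : Set (MGTree G)) (T : MGTree G) : Set (MGTree G) :=
  {T' : MGTree G | T' ∈ D ∧ SimpIso T'.toGTree T.toGTree}

variable (G)

/-- The weak topology on a deformation space `D`: a set is closed if and only if its
intersection with every closed cone of `D` is closed (each closed cone carrying the
Gromov topology). -/
noncomputable def weakTop (D : Set (MGTree G)) : TopologicalSpace ↥D :=
  ⨆ (T : MGTree G) (_ : T ∈ D), TopologicalSpace.coinduced
    (fun x : {S : MGTree G // S ∈ closedCone D T} => (⟨x.1, x.2.1⟩ : ↥D))
    (TopologicalSpace.induced (fun x : {S : MGTree G // S ∈ closedCone D T} => x.1)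
      (gromovTop G))

variable {G}

/-- The projectivizing relation on a deformation space: agreement up to rescaling, i.e.
equivariant homothety. -/
def projRel (D : Set (MGTree G)) (a b : ↥D) : Prop :=
  ∃ c : ℝ, 0 < c ∧ EquivHomothety c a.1 b.1

/-- The relation of equivariant isometry on a deformation space. -/
def isomRel (D : Set (MGTree G)) (a b : ↥D) : Prop := EquivIsometric a.1 b.1

end Topologies

section Morphisms

variable {G : Type u} [Group G]

/-- A morphism of simplicial `G`-trees: an equivariant map sending each edge onto a
non-degenerate edge path (obtained by subdividing the edge into finitely many subsegments,
each mapped bijectively onto an edge). -/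
structure GMorphism (T T' : GTree G) where
  f : T.V → T'.V
  equivariant : ∀ (g : G) (v : T.V), f (T.act g v) = T'.act g (f v)
  edgeWalk : ∀ u v : T.V, T.graph.Adj u v → T'.graph.Walk (f u) (f v)
  edgeWalk_ne_nil : ∀ (u v : T.V) (h : T.graph.Adj u v), ¬(edgeWalk u v h).Nil
  edgeWalk_symm : ∀ (u v : T.V) (h : T.graph.Adj u v),
    (edgeWalk v u h.symm).support = (edgeWalk u v h).support.reverse
  edgeWalk_equivariant : ∀ (g : G) (u v : T.V) (h : T.graph.Adj u v),
    (edgeWalk (T.act g u) (T.act g v) (T.adj_act g u v h)).support =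
      (edgeWalk u v h).support.map (fun x => T'.act g x)

/-- `H` is bi-elliptic in `T`: it fixes two distinct points. -/
def BiElliptic (T : GTree G) (H : Subgroup G) : Prop :=
  ∃ u v : T.V, u ≠ v ∧ ∀ h ∈ H, T.act h u = u ∧ T.act h v = v

/-- `H` is a generalized edge group of `T`: it is squeezed between two edge stabilizers. -/
def GenEdgeGroup (T : GTree G) (H : Subgroup G) : Prop :=
  ∃ u v u' v' : T.V, T.graph.Adj u v ∧ T.graph.Adj u' v' ∧
    T.edgeStab u v ≤ H ∧ H ≤ T.edgeStab u' v'

/-- `H` belongs to `𝒜_min` (relative to the deformation space of `T₀`): it fixes an edge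
in every tree of the deformation space. -/
def Amin (T₀ : GTree G) (H : Subgroup G) : Prop :=
  ∀ T : GTree G, SameDef T₀ T → ∃ u v : T.V, T.graph.Adj u v ∧ H ≤ T.edgeStab u v

/-- A maximal elliptic subgroup (of the deformation space of `T₀`). -/
def MaxElliptic (T₀ : GTree G) (H : Subgroup G) : Prop :=
  T₀.Elliptic H ∧ ∀ K : Subgroup G, T₀.Elliptic K → H ≤ K → K = H

end Morphisms

section OutG

variable (G : Type u) [Group G]

instance innRange_normal : ((MulAut.conj : G →* MulAut G).range).Normal := by
  constructor
  intro a ha φ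
  obtain ⟨g, rfl⟩ := ha
  refine ⟨φ g, ?_⟩
  ext x
  simp only [MulAut.mul_apply, MulAut.conj_apply, map_mul, map_inv]
  simp [MulAut.inv_def]

/-- The outer automorphism group of `G`. -/
def OutG := MulAut G ⧸ (MulAut.conj : G →* MulAut G).range

noncomputable instance : Group (OutG G) := QuotientGroup.Quotient.group _

/-- The class of an automorphism in `Out(G)`. -/
def toOutG (φ : MulAut G) : OutG G := QuotientGroup.mk φ

end OutG
section RealTrees

variable (G : Type u) [Group G]

/-- A non-trivial minimal `ℝ`-tree with an isometric action of `G`: a geodesic metric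
space in which any two points are joined by a unique arc. -/
structure RGTree : Type (u + 1) where
  X : Type u
  [ms : MetricSpace X]
  nontrivial : Nontrivial X
  geodesic : ∀ x y : X, ∃ f : ℝ → X, f 0 = x ∧ f (dist x y) = y ∧
    ∀ s ∈ Set.Icc (0 : ℝ) (dist x y), ∀ t ∈ Set.Icc (0 : ℝ) (dist x y),
      dist (f s) (f t) = |s - t|
  unique_arc : ∀ (x y : X) (γ : Set.Icc (0 : ℝ) 1 → X), Continuous γ →
    Function.Injective γ → γ ⟨0, by constructor <;> norm_num⟩ = x →
    γ ⟨1, by constructor <;> norm_num⟩ = y →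
    ∀ z ∈ Set.range γ, dist x z + dist z y = dist x y
  act : G →* Equiv.Perm X
  isom : ∀ g : G, Isometry (act g)
  minimal : ∀ S : Set X, S.Nonempty → (∀ (g : G), ∀ x ∈ S, act g x ∈ S) →
    (∀ x ∈ S, ∀ y ∈ S, ∀ z : X, dist x z + dist z y = dist x y → z ∈ S) →
    S = Set.univ

attribute [instance] RGTree.ms

variable {G}

namespace RGTree

variable (R : RGTree G)

/-- `z` lies between `x` and `y` (i.e. on the arc from `x` to `y`). -/
def Btw (x z y : R.X) : Prop := dist x z + dist z y = dist x y

/-- A subgroup is elliptic if it fixes a point. -/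
def Elliptic (H : Subgroup G) : Prop := ∃ x : R.X, ∀ h ∈ H, R.act h x = x

/-- A hyperbolic element fixes no point. -/
def Hyperbolic (g : G) : Prop := ∀ x : R.X, R.act g x ≠ x

/-- The translation length of `g`. -/
noncomputable def ell (g : G) : ℝ :=
  sInf {r : ℝ | ∃ x : R.X, r = dist x (R.act g x)}

/-- The characteristic set of `g`: its axis if `g` is hyperbolic, its fixed point set
if `g` is elliptic. -/
def Axis (g : G) : Set R.X := {x : R.X | dist x (R.act g x) = R.ell g}

/-- The fixed point set of `g`. -/
def Fix (g : G) : Set R.X := {x : R.X | R.act g x = x}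

/-- The fixed point set of a subgroup. -/
def FixSub (H : Subgroup G) : Set R.X := {x : R.X | ∀ h ∈ H, R.act h x = x}

/-- Irreducibility: two hyperbolic elements with disjoint characteristic sets. -/
def Irr : Prop :=
  ∃ g h : G, R.Hyperbolic g ∧ R.Hyperbolic h ∧ R.Axis g ∩ R.Axis h = ∅

/-- The distance between the characteristic sets of `g` and `h`. -/
noncomputable def axesDist (g h : G) : ℝ :=
  sInf {r : ℝ | ∃ x ∈ R.Axis g, ∃ y ∈ R.Axis h, r = dist x y}

end RGTree

/-- `f` realizes the metric simplicial `G`-tree `T` inside the `ℝ`-tree `R`. -/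
def IsRealizationMap (R : RGTree G) (T : MGTree G) (f : T.V → R.X) : Prop :=
  (∀ (g : G) (v : T.V), f (T.act g v) = R.act g (f v)) ∧
  (∀ u v : T.V, dist (f u) (f v) = T.dist u v) ∧
  ∀ x : R.X, ∃ u v : T.V, T.graph.Adj u v ∧ R.Btw (f u) x (f v)

/-- The `ℝ`-tree `R` is (equivariantly isometric to) the geometric realization of the
metric simplicial `G`-tree `T`. -/
def RealizationOf (R : RGTree G) (T : MGTree G) : Prop := ∃ f : T.V → R.X, IsRealizationMap R T f

variable (G)

/-- The equivariant Gromov–Hausdorff topology on the space of `ℝ`-trees. -/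
noncomputable def gromovTopR : TopologicalSpace (RGTree G) where
  IsOpen U := ∀ R ∈ U, ∃ (X : Finset R.X) (A : Finset G) (ε : ℝ), 0 < ε ∧
    {R' : RGTree G | ∃ f : R.X → R'.X, ∀ x ∈ X, ∀ y ∈ X, ∀ g ∈ A,
      |dist x (R.act g y) - dist (f x) (R'.act g (f y))| < ε} ⊆ U
  isOpen_univ := fun R _ => ⟨∅, ∅, 1, one_pos, Set.subset_univ _⟩
  isOpen_inter := by
    intro U V hU hV R hR
    obtain ⟨X₁, A₁, ε₁, hε₁, h₁⟩ := hU R hR.1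
    obtain ⟨X₂, A₂, ε₂, hε₂, h₂⟩ := hV R hR.2
    refine ⟨X₁ ∪ X₂, A₁ ∪ A₂, min ε₁ ε₂, lt_min hε₁ hε₂, ?_⟩
    rintro R' ⟨f, hf⟩
    constructor
    · exact h₁ ⟨f, fun x hx y hy g hg =>
        lt_of_lt_of_le (hf x (Finset.mem_union_left _ hx) y (Finset.mem_union_left _ hy) g
          (Finset.mem_union_left _ hg)) (min_le_left _ _)⟩
    · exact h₂ ⟨f, fun x hx y hy g hg =>
        lt_of_lt_of_le (hf x (Finset.mem_union_right _ hx) y (Finset.mem_union_right _ hy) g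
          (Finset.mem_union_right _ hg)) (min_le_right _ _)⟩
  isOpen_sUnion := by
    intro s hs R hR
    obtain ⟨U, hUs, hRU⟩ := hR
    obtain ⟨X, A, ε, hε, h⟩ := hs U hUs R hRU
    exact ⟨X, A, ε, hε, h.trans (Set.subset_sUnion_of_mem hUs)⟩

/-- The axes topology: the coarsest topology making all translation length functions
continuous. -/
noncomputable def axesTopR : TopologicalSpace (RGTree G) :=
  TopologicalSpace.induced (fun (R : RGTree G) (g : G) => R.ell g) Pi.topologicalSpace

variable {G}

/-- A morphism of `ℝ`-trees: an equivariant map such that every segment is a finite union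
of subsegments on each of which the map is isometric. -/
structure RMorphism (R S : RGTree G) where
  f : R.X → S.X
  equivariant : ∀ (g : G) (x : R.X), f (R.act g x) = S.act g (f x)
  piecewise : ∀ x y : R.X, ∃ (n : ℕ) (c : Fin (n + 1) → R.X),
    c 0 = x ∧ c (Fin.last n) = y ∧ (∀ i : Fin (n + 1), R.Btw x (c i) y) ∧
    ∀ i : Fin n, ∀ p q : R.X, R.Btw (c i.castSucc) p (c i.succ) →
      R.Btw (c i.castSucc) q (c i.succ) → dist (f p) (f q) = dist p q

/-- `M` is the intermediate tree at time `t` of Skora's deformation of the morphism `φ`: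
the quotient of the source in which `x` and `y` are identified exactly when `φ` maps the
segment `[x,y]` into the ball of radius `t` around `φ(x) = φ(y)`. -/
def IsSkoraIntermediate {R S : RGTree G} (φ : RMorphism R S) (t : ℝ) (M : RGTree G) : Prop :=
  ∃ (p : R.X → M.X) (q : M.X → S.X), Function.Surjective p ∧
    (∀ (g : G) (x : R.X), p (R.act g x) = M.act g (p x)) ∧
    (∀ (g : G) (m : M.X), q (M.act g m) = S.act g (q m)) ∧
    (∀ x : R.X, q (p x) = φ.f x) ∧
    (∀ x y : R.X, dist (p x) (p y) ≤ dist x y) ∧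
    (∀ m m' : M.X, dist (q m) (q m') ≤ dist m m') ∧
    ∀ x y : R.X, p x = p y ↔ (φ.f x = φ.f y ∧
      ∀ z : R.X, R.Btw x z y → dist (φ.f z) (φ.f x) ≤ t)

/-- `P` is the basepoint of `R` determined by `g` and `h` (the endpoint of the
intersection of the two characteristic sets, resp. the projection of one onto the other),
characterized by the metric system (1) of [Guirardel–Levitt]. -/
noncomputable def IsBasepoint (R : RGTree G) (g h : G) (P : R.X) : Prop :=
  dist P (R.act g P) = R.ell g ∧
  dist P (R.act h P) = R.ell h + 2 * R.axesDist g h ∧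
  dist (R.act g P) (R.act h P) = R.ell g + R.ell h + 2 * R.axesDist g h ∧
  dist (R.act g P) (R.act h⁻¹ P) = R.ell g + R.ell h + 2 * R.axesDist g h

/-- `p` is a projection of `x` to the set `S` (a closest point of `S`). -/
def IsProj (R : RGTree G) (x : R.X) (S : Set R.X) (p : R.X) : Prop :=
  p ∈ S ∧ ∀ q ∈ S, dist x p ≤ dist x q

/-- Equivariant isometry of `ℝ`-trees. -/
def RIsom (R R' : RGTree G) : Prop :=
  ∃ e : R.X ≃ R'.X, (∀ (g : G) (x : R.X), e (R.act g x) = R'.act g (e x)) ∧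
    ∀ x y : R.X, dist (e x) (e y) = dist x y

/-- Equivariant homothety of `ℝ`-trees, with ratio `c`. -/
def RHomothety (c : ℝ) (R R' : RGTree G) : Prop :=
  ∃ e : R.X ≃ R'.X, (∀ (g : G) (x : R.X), e (R.act g x) = R'.act g (e x)) ∧
    ∀ x y : R.X, dist (e x) (e y) = c * dist x y

end RealTrees
section MoreDefs

variable {G : Type u} [Group G]

/-- `H` is contained in a conjugate of `K`. -/
def ConjLe (H K : Subgroup G) : Prop := ∃ g : G, ∀ h ∈ H, g * h * g⁻¹ ∈ K

/-- `H` represents a maximal element of the vertical set `ℳ` associated to the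
deformation space of `T₀`. -/
def MaxVert (T₀ : GTree G) (H : Subgroup G) : Prop :=
  T₀.Elliptic H ∧ ∀ K : Subgroup G, T₀.Elliptic K → ConjLe H K → ConjLe K H

/-- The vertical set `ℳ`: equivalence classes of maximal elements for containment in a
conjugate, among elliptic subgroups. -/
def vertSet (T₀ : GTree G) : Type u :=
  Quot (fun H K : {H : Subgroup G // MaxVert T₀ H} => ConjLe H.1 K.1 ∧ ConjLe K.1 H.1)

namespace GTree

variable (T : GTree G)

/-- The set of `G`-orbits of vertices (the vertices of the quotient graph `T/G`). -/
def vertexOrbits : Type u := Quot (fun u v : T.V => ∃ g : G, T.act g u = v)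

/-- Orbits of neighbours of `v` under the stabilizer of `v`: the oriented edges of the
quotient graph of groups issued from the image of `v`, whose number is the valence of
the image of `v`. -/
def nbrOrbits (v : T.V) : Type u :=
  Quot (fun a b : {w : T.V // T.graph.Adj v w} => ∃ g : G, T.act g v = v ∧ T.act g a.1 = b.1)

/-- The set of `G`-orbits of (non-oriented) edges. -/
def edgeOrbits : Type u :=
  Quot (fun d d' : T.graph.Dart => ∃ g : G, T.dartAct g d = d' ∨ T.dartAct g d = d'.symm)

/-- BF-reduced: if an edge-to-vertex inclusion `G_e → G_u` is onto, then the image of `u`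
in the quotient graph has valence at least 3. -/
def BFReduced : Prop :=
  ∀ u w : T.V, T.graph.Adj u w → T.stab u ≤ T.stab w →
    3 ≤ Cardinal.mk (T.nbrOrbits u)

end GTree

/-- The quotient graph of groups of `T` has a strict ascending loop: an edge whose
endpoints are in the same orbit, exactly one of the two edge-to-vertex inclusions
being onto. -/
def HasSAL (T : GTree G) : Prop :=
  ∃ u v : T.V, T.graph.Adj u v ∧ (∃ g : G, T.act g u = v) ∧
    Xor' (T.stab u ≤ T.stab v) (T.stab v ≤ T.stab u)

/-- The edge (orbit of) `uv` is a surviving edge: `T` can be made reduced by a collapse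
(within its deformation space) not collapsing `uv`. -/
def Surviving (T : GTree G) (u v : T.V) : Prop :=
  ∃ (T' : GTree G) (c : T.V → T'.V), IsCollapseMap T T' c ∧ SameDef T T' ∧
    T'.Reduced ∧ c u ≠ c v

/-- Containment in a conjugate by an element of `G₀`. -/
def perLe (G₀ : Subgroup G) (H K : Subgroup G) : Prop :=
  ∃ g ∈ G₀, ∀ h ∈ H, g * h * g⁻¹ ∈ K

/-- `H` represents a maximal element of the peripheral structure `ℳ₀` of `G₀`. -/
def PeriphMax (T₀ : GTree G) (G₀ : Subgroup G) (H : Subgroup G) : Prop :=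
  H ≤ G₀ ∧ Amin T₀ H ∧
    ∀ K : Subgroup G, K ≤ G₀ → Amin T₀ K → perLe G₀ H K → perLe G₀ K H

/-- The peripheral structure `ℳ₀` of `G₀`, as a set of equivalence classes. -/
def periphSet (T₀ : GTree G) (G₀ : Subgroup G) : Type u :=
  Quot (fun H K : {H : Subgroup G // PeriphMax T₀ G₀ H} =>
    perLe G₀ H.1 K.1 ∧ perLe G₀ K.1 H.1)

end MoreDefs


/-! ## Half-spaces of graphs -/

/-- `S` is a half-space: its edge boundary is exactly the edge from `a ∈ S` to `b ∉ S`. -/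
def Half {V : Type u} (X : SimpleGraph V) (S : Set V) (a b : V) : Prop :=
  X.Adj a b ∧ a ∈ S ∧ b ∉ S ∧ ∀ x y, X.Adj x y → x ∈ S → y ∉ S → x = a ∧ y = b

theorem Half.compl {V : Type u} {X : SimpleGraph V} {S : Set V} {a b : V} (h : Half X S a b) :
    Half X Sᶜ b a := by
  obtain ⟨h1, h2, h3, h4⟩ := h
  refine ⟨h1.symm, h3, fun h => h h2, ?_⟩
  intro x y hxy hx hy
  have := h4 y x hxy.symm (by simpa using hy) hx
  exact ⟨this.2, this.1⟩

theorem exists_half {V : Type u} {X : SimpleGraph V} (hX : X.IsTree) {a b : V} (h : X.Adj a b) :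
    ∃ S, Half X S a b := by
  have hb := SimpleGraph.isAcyclic_iff_forall_adj_isBridge.1 hX.isAcyclic h
  rw [SimpleGraph.isBridge_iff] at hb
  refine ⟨{x | (X.deleteEdges {s(a, b)}).Reachable a x}, h, SimpleGraph.Reachable.refl _, hb, ?_⟩
  intro x y hxy hx hy
  by_cases he : s(x, y) = s(a, b)
  · rcases Sym2.eq_iff.1 he with h' | h'
    · exact h'
    · rw [h'.1] at hx
      exact absurd hx hb
  · exfalso
    apply hy
    refine SimpleGraph.Reachable.trans hx (SimpleGraph.Adj.reachable ?_)
    rw [SimpleGraph.deleteEdges_adj]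
    exact ⟨hxy, by simpa using he⟩

theorem isTree_of_half {V : Type u} {X : SimpleGraph V} (hc : X.Connected)
    (h : ∀ a b, X.Adj a b → ∃ S, Half X S a b) : X.IsTree := by
  refine ⟨hc, SimpleGraph.isAcyclic_iff_forall_adj_isBridge.2 ?_⟩
  intro a b hab
  rw [SimpleGraph.isBridge_iff]
  rintro ⟨p⟩
  obtain ⟨S, -, h2, h3, h4⟩ := h a b hab
  obtain ⟨d, -, hd1, hd2⟩ := p.exists_boundary_dart S h2 h3
  have hd := d.adj
  rw [SimpleGraph.deleteEdges_adj] at hd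
  obtain ⟨e1, e2⟩ := h4 _ _ hd.1 hd1 hd2
  apply hd.2
  rw [e1, e2]
  simp

theorem Half.const {V : Type u} {X : SimpleGraph V} (hc : X.Connected) {S : Set V} {a b : V}
    (h : Half X S a b) (P : V → Prop)
    (hP : ∀ x y, X.Adj x y → x ∈ S → y ∈ S → P x → P y) (x : V) (hx : x ∈ S) :
    P x ↔ P a := by
  obtain ⟨p⟩ := hc.preconnected x a
  obtain ⟨h1, h2, h3, h4⟩ := h
  induction p with
  | nil => rfl
  | @cons x y z hxy p ih =>
    by_cases hy : y ∈ S
    · rw [← ih hy h1 h2 h4]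
      exact ⟨hP _ _ hxy hx hy, hP _ _ hxy.symm hy hx⟩
    · rw [(h4 _ _ hxy hx hy).1]

theorem Half.mem_support {V : Type u} {X : SimpleGraph V} {S : Set V} {a b : V}
    (h : Half X S a b) {x y : V} (p : X.Walk x y) (hx : x ∈ S) (hy : y ∉ S) :
    a ∈ p.support ∧ b ∈ p.support := by
  obtain ⟨d, hd, hd1, hd2⟩ := p.exists_boundary_dart S hx hy
  obtain ⟨e1, e2⟩ := h.2.2.2 _ _ d.adj hd1 hd2
  subst e1 e2
  exact ⟨p.dart_fst_mem_support_of_mem_darts hd, p.dart_snd_mem_support_of_mem_darts hd⟩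

theorem Half.path {V : Type u} {X : SimpleGraph V} {S : Set V} {a b : V}
    (h : Half X S a b) {x y : V} (p : X.Walk x y) (hp : p.IsPath) (hx : x ∉ S) (hy : y ∉ S)
    (w : V) (hw : w ∈ p.support) : w ∉ S := by
  intro hwS
  have h1 := (h.compl.mem_support (p.takeUntil w hw) hx (by simpa using hwS)).1
  have h2 := (h.mem_support (p.dropUntil w hw) hwS hy).2
  have hb : b ≠ w := fun e => h.2.2.1 (e ▸ hwS)
  have hs := p.take_spec hw
  rw [← hs] at hp
  have := hp.support_nodup
  rw [SimpleGraph.Walk.support_append] at this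
  rw [List.nodup_append'] at this
  refine this.2.2 h1 ?_
  rw [SimpleGraph.Walk.mem_support_iff] at h2
  exact h2.resolve_left hb

/-- Two half-spaces never cross. -/
theorem Half.cross {V : Type u} {X : SimpleGraph V} (hc : X.Connected) {S S' : Set V}
    {a b a' b' : V} (h : Half X S a b) (h' : Half X S' a' b')
    {x y z w : V} (hx : x ∈ S) (hx' : x ∈ S') (hy : y ∈ S) (hy' : y ∉ S')
    (hz : z ∉ S) (hz' : z ∈ S') (hw : w ∉ S) (hw' : w ∉ S') : False := by
  by_cases hab : a' ∈ S ∧ b' ∈ S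
  · have key := h.compl.const hc (fun v => v ∈ S') (by
      intro p q hpq hp hq hp'
      by_contra hq'
      exact hp ((h'.2.2.2 p q hpq hp' hq').1 ▸ hab.1))
    exact hw' ((key w hw).2 ((key z hz).1 hz'))
  · have key := h.const hc (fun v => v ∈ S') (by
      intro p q hpq hp hq hp'
      by_contra hq'
      obtain ⟨e1, e2⟩ := h'.2.2.2 p q hpq hp' hq'
      exact hab ⟨e1 ▸ hp, e2 ▸ hq⟩)
    exact hy' ((key y hy).2 ((key x hx).1 hx'))

section GT
variable {G : Type u} [Group G]

namespace GTree
variable (T : GTree G)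

theorem act_mul (g h : G) (x : T.V) : T.act (g * h) x = T.act g (T.act h x) := by
  rw [map_mul, Equiv.Perm.mul_apply]

@[simp] theorem act_one (x : T.V) : T.act 1 x = x := by simp

@[simp] theorem act_inv_act (g : G) (x : T.V) : T.act g⁻¹ (T.act g x) = x := by
  rw [← act_mul]; simp

@[simp] theorem act_act_inv (g : G) (x : T.V) : T.act g (T.act g⁻¹ x) = x := by
  rw [← act_mul]; simp

theorem act_eq_iff (g : G) (x y : T.V) : T.act g x = y ↔ x = T.act g⁻¹ y := by
  constructor
  · rintro rfl; simp
  · rintro rfl; simp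

theorem adj_act_iff (g : G) (x y : T.V) :
    T.graph.Adj (T.act g x) (T.act g y) ↔ T.graph.Adj x y := by
  constructor
  · intro h
    simpa using T.adj_act g⁻¹ _ _ h
  · exact T.adj_act g x y

theorem mem_stab (g : G) (x : T.V) : g ∈ T.stab x ↔ T.act g x = x := Iff.rfl

theorem mem_stab_act (g h : G) (x : T.V) : g ∈ T.stab (T.act h x) ↔ h⁻¹ * g * h ∈ T.stab x := by
  rw [mem_stab, mem_stab, act_mul, act_mul, T.act_eq_iff h⁻¹, inv_inv]

/-- translate of a half-space -/
theorem half_translate (g : G) {S : Set T.V} {a b : T.V} (h : Half T.graph S a b) :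
    Half T.graph {x | T.act g⁻¹ x ∈ S} (T.act g a) (T.act g b) := by
  obtain ⟨h1, h2, h3, h4⟩ := h
  refine ⟨T.adj_act g _ _ h1, by simpa using h2, by simpa using h3, ?_⟩
  intro x y hxy hx hy
  have := h4 _ _ (T.adj_act g⁻¹ _ _ hxy) hx hy
  rw [← this.1, ← this.2]
  simp

theorem conn : T.graph.Connected := T.isTree.connected

/-- Every orbit meets every half-space. -/
theorem orbit_meets {S : Set T.V} {a b : T.V} (h : Half T.graph S a b) (x : T.V) :
    ∃ g : G, T.act g x ∈ S := by
  by_contra hcon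
  push Not at hcon
  have := T.minimal {z | ∀ g : G, T.act g z ∉ S} ⟨x, hcon⟩ (by
    intro g v hv k
    rw [← act_mul]
    exact hv _) (by
    intro y hy z hz p hp w hw g hgw
    have hh := T.half_translate g⁻¹ h
    exact hh.path p hp (by simpa using hy g) (by simpa using hz g) w hw (by simpa using hgw))
  have h2 : a ∈ {z | ∀ g : G, T.act g z ∉ S} := by rw [this]; trivial
  exact h2 1 (by simpa using h.2.1)

/-- if `g` fixes the endpoint `b` and moves `a`, then it moves the half space off itself -/
theorem moveHalf {S : Set T.V} {a b : T.V} (h : Half T.graph S a b) (g : G)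
    (hb : T.act g b = b) (ha : T.act g a ≠ a) (z : T.V) (hz : z ∈ S) : T.act g z ∉ S := by
  have hh := T.half_translate g h
  have hna : T.act g a ∉ S := by
    intro h'
    have := h.2.2.2 (T.act g a) b (by have := T.adj_act g _ _ h.1; rwa [hb] at this) h' h.2.2.1
    exact ha this.1
  have key := hh.const T.conn (fun v => v ∈ S) (by
    intro p q hpq hp hq hpS
    by_contra hqS
    have := (h.2.2.2 p q hpq hpS hqS).2
    subst this
    have := hh.2.2.1
    rw [hb] at this
    exact this hq)
  intro h'
  exact hna ((key (T.act g z) (by simpa using hz)).1 h')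

theorem mk_minimal {V : Type u} (X : SimpleGraph V) (hc : X.Connected)
    (act : G →* Equiv.Perm V)
    (hh : ∀ a b, X.Adj a b → ∃ S, Half X S a b ∧ ∀ x, ∃ g : G, act g x ∈ S)
    (S : Set V) (hS : S.Nonempty) (hinv : ∀ (g : G), ∀ v ∈ S, act g v ∈ S)
    (hconv : ∀ u ∈ S, ∀ v ∈ S, ∀ p : X.Walk u v, p.IsPath → ∀ w ∈ p.support, w ∈ S) :
      S = Set.univ := by
  obtain ⟨x, hx⟩ := hS
  by_contra hne'
  obtain ⟨y, hy⟩ := (Set.ne_univ_iff_exists_notMem S).1 hne'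
  obtain ⟨p⟩ := hc.preconnected x y
  obtain ⟨d, -, hd1, hd2⟩ := p.exists_boundary_dart S hx hy
  obtain ⟨A, hA, hA2⟩ := hh d.snd d.fst d.adj.symm
  obtain ⟨g, hg⟩ := hA2 x
  obtain ⟨q, hq⟩ := (hc.preconnected (act g x) d.fst).exists_isPath
  have := (hA.mem_support q hg hA.2.2.1).1
  exact hd2 (hconv _ (hinv g x hx) _ hd1 q hq _ this)

/-- Build a `G`-tree from half-spaces. -/
def build (V : Type u) (X : SimpleGraph V) (hc : X.Connected)
    (act : G →* Equiv.Perm V)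
    (adj_act : ∀ (g : G) (u v : V), X.Adj u v → X.Adj (act g u) (act g v))
    (noInv : ∀ (g : G) (u v : V), X.Adj u v → ¬(act g u = v ∧ act g v = u))
    (hh : ∀ a b, X.Adj a b → ∃ S, Half X S a b ∧ ∀ x, ∃ g : G, act g x ∈ S) : GTree G where
  V := V
  nonempty := hc.nonempty
  graph := X
  isTree := isTree_of_half hc fun a b hab => (hh a b hab).imp fun _ h => h.1
  act := act
  adj_act := adj_act
  noInversion := noInv
  minimal := mk_minimal X hc act hh

end GTree

/-- pull back of half-spaces under collapses -/
theorem half_collapse {T T' : GTree G} {c : T.V → T'.V} (hc : IsCollapseMap T T' c)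
    {S : Set T'.V} {a b : T'.V} (h : Half T'.graph S a b) :
    ∃ x y, Half T.graph (c ⁻¹' S) x y := by
  obtain ⟨c1, c2, c3, c4, c5⟩ := hc
  obtain ⟨h1, h2, h3, h4⟩ := h
  obtain ⟨x, y, hxy, rfl, rfl⟩ := c4 a b h1
  refine ⟨x, y, hxy, h2, h3, ?_⟩
  intro x' y' hxy' hx' hy'
  have hne : c x' ≠ c y' := fun e => hy' (by simpa [e] using hx')
  obtain ⟨e1, e2⟩ := h4 _ _ (c3 x' y' hxy' hne) hx' hy'
  obtain ⟨R, hR⟩ := exists_half T.isTree hxy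
  have hne2 : c x ≠ c y := by rw [← e1, ← e2]; exact hne
  have hx'R : x' ∈ R := by
    by_contra hn
    obtain ⟨q, hq⟩ := (T.conn.preconnected x x').exists_isPath
    have := (hR.mem_support q hR.2.1 hn).2
    exact hne2 (c5 x x' e1.symm q hq y this).symm
  have hy'R : y' ∉ R := by
    intro hn
    obtain ⟨q, hq⟩ := (T.conn.preconnected y' y).exists_isPath
    have := (hR.mem_support q hn hR.2.2.1).1
    exact hne2 ((c5 y' y e2 q hq x this).trans e2)
  exact hR.2.2.2 x' y' hxy' hx'R hy'R

end GT


section SlideSec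
variable {G : Type u} [Group G]

/-- Sliding datum -/
structure SlideD (T : GTree G) (φ : T.V → T.V) : Prop where
  eqv : ∀ g x, φ (T.act g x) = T.act g (φ x)
  adj : ∀ x, φ x ≠ x → T.graph.Adj x (φ x)
  mv : ∀ x, φ x ≠ x → φ (φ x) ≠ φ x
  nb : ∀ x, φ x ≠ x → φ (φ x) ≠ x
  surj : ∀ x, ∃ y, φ y = x

/-- adjacency by an edge which is not of the form `{x, φ x}` -/
def NE (T : GTree G) (φ : T.V → T.V) (x y : T.V) : Prop :=
  T.graph.Adj x y ∧ y ≠ φ x ∧ x ≠ φ y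

theorem NE.symm {T : GTree G} {φ : T.V → T.V} {x y : T.V} (h : NE T φ x y) : NE T φ y x :=
  ⟨h.1.symm, h.2.2, h.2.1⟩

/-- The graph obtained by sliding -/
def slideGraph (T : GTree G) (φ : T.V → T.V) (n : ℕ) : SimpleGraph T.V where
  Adj a b := a ≠ b ∧ (b = φ a ∨ a = φ b ∨ ∃ x y, NE T φ x y ∧ φ^[n] x = a ∧ φ^[n] y = b)
  symm := ⟨by
    rintro a b ⟨h, h1 | h1 | ⟨x, y, h1, h2, h3⟩⟩
    · exact ⟨h.symm, Or.inr (Or.inl h1)⟩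
    · exact ⟨h.symm, Or.inl h1⟩
    · exact ⟨h.symm, Or.inr (Or.inr ⟨y, x, h1.symm, h3, h2⟩)⟩⟩
  loopless := ⟨fun a h => h.1 rfl⟩

namespace SlideD
variable {T : GTree G} {φ : T.V → T.V}

theorem eqv_iter (hs : SlideD T φ) (n : ℕ) (g : G) (x : T.V) : φ^[n] (T.act g x) = T.act g (φ^[n] x) := by
  induction n with
  | zero => rfl
  | succ n ih => rw [Function.iterate_succ_apply', Function.iterate_succ_apply', ih, hs.eqv]

theorem mv_iter (hs : SlideD T φ) (n : ℕ) (x : T.V) (h : φ x ≠ x) : φ (φ^[n] x) ≠ φ^[n] x := by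
  induction n with
  | zero => exact h
  | succ n ih => rw [Function.iterate_succ_apply']; exact hs.mv _ ih

theorem surj_iter (hs : SlideD T φ) (n : ℕ) (x : T.V) : ∃ y, φ^[n] y = x := by
  induction n generalizing x with
  | zero => exact ⟨x, rfl⟩
  | succ n ih =>
    obtain ⟨y, rfl⟩ := hs.surj x
    obtain ⟨z, rfl⟩ := ih y
    exact ⟨z, Function.iterate_succ_apply' _ _ _⟩

theorem mv_of_iter (n : ℕ) (x : T.V) (h : φ (φ^[n] x) ≠ φ^[n] x) : φ x ≠ x := by
  intro e
  have : φ^[n] x = x := Function.iterate_fixed e n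
  rw [this] at h
  exact h e

theorem ne_mem (hs : SlideD T φ) {N : Set T.V} {x y : T.V} (h : Half T.graph N x y) (hne : NE T φ x y) (z : T.V) :
    φ z ∈ N ↔ z ∈ N := by
  by_cases hz : φ z = z
  · rw [hz]
  constructor
  · intro h1
    by_contra h2
    obtain ⟨e1, e2⟩ := h.2.2.2 _ _ (hs.adj z hz).symm h1 h2
    apply hne.2.2
    rw [← e1, ← e2]
  · intro h1
    by_contra h2
    obtain ⟨e1, e2⟩ := h.2.2.2 _ _ (hs.adj z hz) h1 h2
    apply hne.2.1
    rw [← e1, ← e2]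

theorem ne_mem_iter (hs : SlideD T φ) (n : ℕ) {N : Set T.V} {x y : T.V} (h : Half T.graph N x y)
    (hne : NE T φ x y) (z : T.V) : φ^[n] z ∈ N ↔ z ∈ N := by
  induction n with
  | zero => rfl
  | succ n ih => rw [Function.iterate_succ_apply', hs.ne_mem h hne, ih]

theorem ne_half (hs : SlideD T φ) (n : ℕ) {N : Set T.V} {x y : T.V} (h : Half T.graph N x y)
    (hne : NE T φ x y) : Half (slideGraph T φ n) N (φ^[n] x) (φ^[n] y) := by
  have hx : φ^[n] x ∈ N := (hs.ne_mem_iter n h hne x).2 h.2.1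
  have hy : φ^[n] y ∉ N := fun h' => h.2.2.1 ((hs.ne_mem_iter n h hne y).1 h')
  refine ⟨⟨fun e => hy (e ▸ hx), Or.inr (Or.inr ⟨x, y, hne, rfl, rfl⟩)⟩, hx, hy, ?_⟩
  rintro a b ⟨hab, h1 | h1 | ⟨x', y', h1, rfl, rfl⟩⟩ ha hb
  · rw [h1, hs.ne_mem h hne] at hb
    exact absurd ha hb
  · rw [h1, hs.ne_mem h hne] at ha
    exact absurd ha hb
  · rw [hs.ne_mem_iter n h hne] at ha hb
    obtain ⟨rfl, rfl⟩ := h.2.2.2 _ _ h1.1 ha hb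
    exact ⟨rfl, rfl⟩

theorem noenter (hs : SlideD T φ) {B : Set T.V} {x : T.V} (h : Half T.graph B x (φ x)) (z : T.V)
    (hz : φ z ∈ B) : z ∈ B := by
  by_contra h2
  have hne : φ z ≠ z := fun e => h2 (e ▸ hz)
  obtain ⟨e1, e2⟩ := h.2.2.2 _ _ (hs.adj z hne).symm hz h2
  apply hs.nb z hne
  rw [e1, ← e2]

theorem noenter_iter (hs : SlideD T φ) (n : ℕ) {B : Set T.V} {x : T.V} (h : Half T.graph B x (φ x)) (z : T.V)
    (hz : φ^[n] z ∈ B) : z ∈ B := by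
  induction n with
  | zero => exact hz
  | succ n ih =>
    rw [Function.iterate_succ_apply'] at hz
    exact ih (hs.noenter h _ hz)

theorem exit (hs : SlideD T φ) {B : Set T.V} {x : T.V} (h : Half T.graph B x (φ x)) (z : T.V)
    (hz : z ∈ B) (hz' : φ z ∉ B) : z = x := by
  have hne : φ z ≠ z := fun e => hz' (e.symm ▸ hz)
  exact (h.2.2.2 _ _ (hs.adj z hne) hz hz').1

theorem exit_iter (hs : SlideD T φ) (n : ℕ) {B : Set T.V} {x : T.V} (h : Half T.graph B x (φ x)) (z : T.V)
    (hz : z ∈ B) (hz' : φ^[n] z ∉ B) : ∃ i < n, φ^[i] z = x := by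
  induction n with
  | zero => exact absurd hz hz'
  | succ n ih =>
    by_cases h' : φ^[n] z ∈ B
    · rw [Function.iterate_succ_apply'] at hz'
      exact ⟨n, Nat.lt_succ_self n, hs.exit h _ h' hz'⟩
    · obtain ⟨i, hi, e⟩ := ih h'
      exact ⟨i, by omega, e⟩

theorem sub_half (hs : SlideD T φ) (n : ℕ) {R R' : Set T.V} {y : T.V} (h' : Half T.graph R' y (φ y))
    (h : Half T.graph R (φ^[n] y) (φ (φ^[n] y))) : R' ⊆ R := by
  have key := h'.const T.conn (fun v => v ∈ R) (by
    intro p q hpq hp hq hpR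
    by_contra hqR
    have := (h.2.2.2 p q hpq hpR hqR).2
    rw [this, ← Function.iterate_succ_apply' φ n y, Function.iterate_succ_apply] at hq
    exact h'.2.2.1 (hs.noenter_iter n h' _ hq))
  intro z hz
  exact (key z hz).2 (hs.noenter_iter n h _ h.2.1)

theorem e_half (hs : SlideD T φ) (n : ℕ) (x : T.V) (hx : φ x ≠ x) :
    ∃ D, Half (slideGraph T φ n) D x (φ x) ∧
      (∀ R, Half T.graph R x (φ x) → D ⊆ R) ∧
      (∀ y R, φ^[n] y = x → Half T.graph R y (φ y) → R ⊆ D) := by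
  let D : Set T.V := {z | (∃ k < n, φ^[k] z = x) ∨
    ∃ y R, φ^[n] y = x ∧ Half T.graph R y (φ y) ∧ z ∈ R}
  have hmv : ∀ k z, φ^[k] z = x → φ z ≠ z := by
    intro k z e
    exact mv_of_iter k z (by rw [e]; exact hx)
  have exR : ∀ y, φ y ≠ y → ∃ R, Half T.graph R y (φ y) := fun y hy =>
    exists_half T.isTree (hs.adj y hy)
  have hB : ∀ z, (∃ y R, φ^[n] y = x ∧ Half T.graph R y (φ y) ∧ z ∈ R) ↔ φ^[n] z ∈ D := by
    intro z
    constructor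
    · rintro ⟨y, R, e, hR, hz⟩
      by_cases hz' : φ^[n] z ∈ R
      · exact Or.inr ⟨y, R, e, hR, hz'⟩
      · obtain ⟨i, hi, e'⟩ := hs.exit_iter n hR z hz hz'
        left
        refine ⟨i, hi, ?_⟩
        rw [← Function.iterate_add_apply, add_comm, Function.iterate_add_apply, e', e]
    · rintro (⟨k, hk, e⟩ | ⟨y, R, e, hR, hz⟩)
      · rw [← Function.iterate_add_apply, add_comm, Function.iterate_add_apply] at e
        obtain ⟨R, hR⟩ := exR (φ^[k] z) (hmv n _ e)
        exact ⟨φ^[k] z, R, e, hR, hs.noenter_iter k hR z hR.2.1⟩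
      · exact ⟨y, R, e, hR, hs.noenter_iter n hR z hz⟩
  have hNE : ∀ p q, NE T φ p q → φ^[n] p ∈ D → φ^[n] q ∈ D := by
    intro p q hpq hp
    rw [← hB] at hp ⊢
    obtain ⟨y, R, e, hR, hz⟩ := hp
    refine ⟨y, R, e, hR, ?_⟩
    by_contra hq
    obtain ⟨e1, e2⟩ := hR.2.2.2 p q hpq.1 hz hq
    exact hpq.2.1 (by rw [e1, e2])
  have hxD : x ∈ D := by
    rcases n with - | n
    · obtain ⟨R, hR⟩ := exR x hx
      exact Or.inr ⟨x, R, rfl, hR, hR.2.1⟩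
    · exact Or.inl ⟨0, Nat.succ_pos n, rfl⟩
  have hxD' : φ x ∉ D := by
    rintro (⟨k, hk, e⟩ | ⟨y, R, e, hR, hz⟩)
    · obtain ⟨R, hR⟩ := exR x hx
      exact hR.2.2.1 (hs.noenter_iter k hR _ (by rw [e]; exact hR.2.1))
    · rw [← e, ← Function.iterate_succ_apply' φ n y, Function.iterate_succ_apply] at hz
      exact hR.2.2.1 (hs.noenter_iter n hR _ hz)
  refine ⟨D, ⟨⟨hx.symm, Or.inl rfl⟩, hxD, hxD', ?_⟩, ?_, ?_⟩
  · rintro a b ⟨hab, h1 | h1 | ⟨x', y', h1, rfl, rfl⟩⟩ ha hb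
    · subst h1
      have : a = x := by
        rcases ha with ⟨k, hk, e⟩ | ⟨y, R, e, hR, hz⟩
        · rcases k with - | k
          · exact e
          · exact absurd (Or.inl ⟨k, by omega, e⟩) hb
        · have hy : a = y := by
            apply hs.exit hR a hz
            intro h'
            exact hb (Or.inr ⟨y, R, e, hR, h'⟩)
          subst hy
          rcases n with - | n
          · exact e
          · exact absurd (Or.inl ⟨n, by omega, e⟩) hb
      rw [this]
      exact ⟨rfl, rfl⟩
    · exfalso
      subst h1
      rcases ha with ⟨k, hk, e⟩ | ⟨y, R, e, hR, hz⟩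
      · by_cases hk' : k + 1 < n
        · exact hb (Or.inl ⟨k + 1, hk', e⟩)
        · have : n = k + 1 := by omega
          subst this
          obtain ⟨R, hR⟩ := exR b (hmv (k + 1) b e)
          exact hb (Or.inr ⟨b, R, e, hR, hR.2.1⟩)
      · exact hb (Or.inr ⟨y, R, e, hR, hs.noenter hR _ hz⟩)
    · exact absurd (hNE _ _ h1 ha) hb
  · intro R hR z hz
    rcases hz with ⟨k, hk, e⟩ | ⟨y, R', e, hR', hz⟩
    · exact hs.noenter_iter k hR z (by rw [e]; exact hR.2.1)
    · subst e
      exact hs.sub_half n hR' hR hz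
  · intro y R e hR z hz
    exact Or.inr ⟨y, R, e, hR, hz⟩

theorem slide_conn (hs : SlideD T φ) (n : ℕ) : (slideGraph T φ n).Connected := by
  have h1 : ∀ z, (slideGraph T φ n).Reachable z (φ z) := by
    intro z
    by_cases hz : φ z = z
    · rw [hz]
    · exact SimpleGraph.Adj.reachable ⟨Ne.symm hz, Or.inl rfl⟩
  have h2 : ∀ k z, (slideGraph T φ n).Reachable z (φ^[k] z) := by
    intro k z
    induction k with
    | zero => exact SimpleGraph.Reachable.refl _
    | succ k ih => rw [Function.iterate_succ_apply']; exact ih.trans (h1 _)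
  have h3 : ∀ x y, T.graph.Adj x y → (slideGraph T φ n).Reachable x y := by
    intro x y hxy
    by_cases e1 : y = φ x
    · rw [e1]; exact h1 x
    by_cases e2 : x = φ y
    · rw [e2]; exact (h1 y).symm
    refine (h2 n x).trans (SimpleGraph.Reachable.trans ?_ (h2 n y).symm)
    obtain ⟨N, hN⟩ := exists_half T.isTree hxy
    exact (hs.ne_half n hN ⟨hxy, e1, e2⟩).1.reachable
  haveI := T.nonempty
  refine ⟨fun x y => ?_⟩
  obtain ⟨p⟩ := T.conn.preconnected x y
  induction p with
  | nil => exact SimpleGraph.Reachable.refl _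
  | cons h p ih => exact (h3 _ _ h).trans ih

theorem ne_act (hs : SlideD T φ) {x y : T.V} (g : G) (h : NE T φ x y) : NE T φ (T.act g x) (T.act g y) := by
  refine ⟨T.adj_act g _ _ h.1, ?_, ?_⟩
  · rw [hs.eqv]; exact fun e => h.2.1 ((T.act g).injective e)
  · rw [hs.eqv]; exact fun e => h.2.2 ((T.act g).injective e)

theorem slide_adj_act (hs : SlideD T φ) (n : ℕ) (g : G) (a b : T.V) (h : (slideGraph T φ n).Adj a b) :
    (slideGraph T φ n).Adj (T.act g a) (T.act g b) := by
  obtain ⟨hab, h⟩ := h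
  refine ⟨fun e => hab ((T.act g).injective e), ?_⟩
  rcases h with h | h | ⟨x, y, h, rfl, rfl⟩
  · left; rw [hs.eqv, h]
  · right; left; rw [hs.eqv, h]
  · right; right
    exact ⟨_, _, hs.ne_act g h, hs.eqv_iter n g x, hs.eqv_iter n g y⟩

/-- key rigidity: an element fixing both ends of a slid edge fixes its original ends -/
theorem ne_rigid (hs : SlideD T φ) (n : ℕ) (g : G) {x y : T.V} (h : NE T φ x y)
    (hx : φ^[n] (T.act g x) = φ^[n] x) (hy : φ^[n] (T.act g y) = φ^[n] y) :
    T.act g x = x ∧ T.act g y = y := by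
  obtain ⟨N, hN⟩ := exists_half T.isTree h.1
  have h1 : T.act g x ∈ N := by
    rw [← hs.ne_mem_iter n hN h, hx, hs.ne_mem_iter n hN h]; exact hN.2.1
  have h2 : T.act g y ∉ N := by
    rw [← hs.ne_mem_iter n hN h, hy, hs.ne_mem_iter n hN h]; exact hN.2.2.1
  exact hN.2.2.2 _ _ (T.adj_act g _ _ h.1) h1 h2

theorem slide_noInv (hs : SlideD T φ) (n : ℕ) (g : G) (a b : T.V) (h : (slideGraph T φ n).Adj a b) :
    ¬(T.act g a = b ∧ T.act g b = a) := by
  obtain ⟨hab, h⟩ := h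
  rcases h with h | h | ⟨x, y, h, rfl, rfl⟩
  · subst h
    exact T.noInversion g _ _ (hs.adj a (Ne.symm hab))
  · subst h
    exact T.noInversion g _ _ (hs.adj b hab).symm
  · rintro ⟨e1, e2⟩
    obtain ⟨N, hN⟩ := exists_half T.isTree h.1
    rw [← hs.eqv_iter] at e1 e2
    have h1 : T.act g x ∉ N := by
      rw [← hs.ne_mem_iter n hN h, e1, hs.ne_mem_iter n hN h]; exact hN.2.2.1
    have h2 : T.act g y ∈ N := by
      rw [← hs.ne_mem_iter n hN h, e2, hs.ne_mem_iter n hN h]; exact hN.2.1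
    obtain ⟨e3, e4⟩ := hN.2.2.2 _ _ (T.adj_act g _ _ h.1).symm h2 h1
    exact T.noInversion g _ _ h.1 ⟨e4, e3⟩

theorem slide_half (hs : SlideD T φ) (n : ℕ) (a b : T.V) (h : (slideGraph T φ n).Adj a b) :
    ∃ S, Half (slideGraph T φ n) S a b ∧ ∀ x, ∃ g : G, T.act g x ∈ S := by
  obtain ⟨hab, h⟩ := h
  rcases h with h | h | ⟨x, y, h, rfl, rfl⟩
  · subst h
    obtain ⟨D, hD, -, hD2⟩ := hs.e_half n a (Ne.symm hab)
    refine ⟨D, hD, fun x => ?_⟩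
    obtain ⟨y, hy⟩ := hs.surj_iter n a
    obtain ⟨R, hR⟩ := exists_half T.isTree (hs.adj y (mv_of_iter n y (by
      rw [hy]; exact Ne.symm hab)))
    obtain ⟨g, hg⟩ := T.orbit_meets hR x
    exact ⟨g, hD2 y R hy hR hg⟩
  · subst h
    obtain ⟨D, hD, hD2, -⟩ := hs.e_half n b hab
    refine ⟨Dᶜ, hD.compl, fun x => ?_⟩
    obtain ⟨R, hR⟩ := exists_half T.isTree (hs.adj b hab)
    obtain ⟨g, hg⟩ := T.orbit_meets hR.compl x
    exact ⟨g, fun h' => hg (hD2 R hR h')⟩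
  · obtain ⟨N, hN⟩ := exists_half T.isTree h.1
    exact ⟨N, hs.ne_half n hN h, T.orbit_meets hN⟩

/-- The slid tree -/
def slide (hs : SlideD T φ) (n : ℕ) : GTree G :=
  GTree.build T.V (slideGraph T φ n) (hs.slide_conn n) T.act (hs.slide_adj_act n)
    (hs.slide_noInv n) (hs.slide_half n)

theorem slide_sameDef (hs : SlideD T φ) (n : ℕ) : SameDef T (hs.slide n) := fun _ => Iff.rfl

end SlideD

/-- The map sending `g a` to `g b`. -/
theorem exists_push (T : GTree G) (a b : T.V) (h : T.stab a ≤ T.stab b) :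
    ∃ φ : T.V → T.V, (∀ g, φ (T.act g a) = T.act g b) ∧
      (∀ x, (¬ ∃ g, T.act g a = x) → φ x = x) ∧
      (∀ g x, φ (T.act g x) = T.act g (φ x)) := by
  let φ : T.V → T.V := fun x => if h : ∃ g, T.act g a = x then T.act h.choose b else x
  have h1 : ∀ g, φ (T.act g a) = T.act g b := by
    intro g
    have hex : ∃ g', T.act g' a = T.act g a := ⟨g, rfl⟩
    have e : φ (T.act g a) = T.act hex.choose b := dif_pos hex
    rw [e]
    have e2 : T.act hex.choose a = T.act g a := hex.choose_spec
    have : g⁻¹ * hex.choose ∈ T.stab a := by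
      rw [T.mem_stab, T.act_mul, e2]; simp
    have := h this
    rw [T.mem_stab, T.act_mul, T.act_eq_iff] at this
    simpa using this
  have h2 : ∀ x, (¬ ∃ g, T.act g a = x) → φ x = x := fun x hx => dif_neg hx
  refine ⟨φ, h1, h2, ?_⟩
  intro g x
  by_cases hx : ∃ k, T.act k a = x
  · obtain ⟨k, rfl⟩ := hx
    rw [h1, ← T.act_mul, h1, T.act_mul]
  · rw [h2 x hx, h2]
    rintro ⟨k, hk⟩
    exact hx ⟨g⁻¹ * k, by rw [T.act_mul, hk]; simp⟩

/-- sliding datum of an ascending loop -/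
theorem exists_slideD (T : GTree G) (u : T.V) (t : G) (hadj : T.graph.Adj u (T.act t u))
    (hle : T.stab u ≤ T.stab (T.act t u)) :
    ∃ φ : T.V → T.V, SlideD T φ ∧ (∀ g, φ (T.act g u) = T.act (g * t) u) ∧
      (∀ x, φ x ≠ x ↔ ∃ g, T.act g u = x) := by
  obtain ⟨φ, h1, h2, h3⟩ := exists_push T u _ hle
  have h1' : ∀ g, φ (T.act g u) = T.act (g * t) u := by
    intro g; rw [h1, T.act_mul]
  have hmv : ∀ x, φ x ≠ x ↔ ∃ g, T.act g u = x := by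
    intro x
    constructor
    · intro h
      by_contra h'
      exact h (h2 x h')
    · rintro ⟨g, rfl⟩
      rw [h1]
      exact (T.adj_act g _ _ hadj).ne'
  refine ⟨φ, ⟨h3, ?_, ?_, ?_, ?_⟩, h1', hmv⟩
  · intro x hx
    obtain ⟨g, rfl⟩ := (hmv x).1 hx
    rw [h1]
    exact T.adj_act g _ _ hadj
  · intro x hx
    obtain ⟨g, rfl⟩ := (hmv x).1 hx
    rw [hmv, h1']
    exact ⟨_, rfl⟩
  · intro x hx
    obtain ⟨g, rfl⟩ := (hmv x).1 hx
    rw [h1', h1']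
    intro e
    rw [T.act_mul, T.act_mul] at e
    have e' := (T.act g).injective e
    exact T.noInversion t _ _ hadj ⟨rfl, e'⟩
  · intro x
    by_cases hx : ∃ g, T.act g u = x
    · obtain ⟨g, rfl⟩ := hx
      exact ⟨T.act (g * t⁻¹) u, by rw [h1']; simp⟩
    · exact ⟨x, h2 x hx⟩

/-- collapsing a collapsible edge -/
theorem exists_collapse (T : GTree G) (a b : T.V) (hab : T.graph.Adj a b)
    (hle : T.stab a ≤ T.stab b) (hor : ¬ ∃ g, T.act g a = b) :
    ∃ T' : GTree G, SameDef T T' ∧ ∃ ι : T'.V → T.V,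
      Function.Injective ι ∧ (∀ x, (∃ z, ι z = x) ↔ ¬ ∃ g, T.act g a = x) ∧
      (∀ g z, ι (T'.act g z) = T.act g (ι z)) ∧
      (∀ z w, T.graph.Adj (ι z) (ι w) → T'.graph.Adj z w) := by
  obtain ⟨ψ, h1, h2, h3⟩ := exists_push T a b hle
  let W := {x : T.V // ¬ ∃ g, T.act g a = x}
  have horb : ∀ g x, (∃ k, T.act k a = T.act g x) ↔ ∃ k, T.act k a = x := by
    intro g x
    constructor
    · rintro ⟨k, hk⟩
      exact ⟨g⁻¹ * k, by rw [T.act_mul, hk]; simp⟩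
    · rintro ⟨k, rfl⟩
      exact ⟨g * k, T.act_mul _ _ _⟩
  have hψ : ∀ x, ¬ ∃ g, T.act g a = ψ x := by
    intro x
    by_cases hx : ∃ g, T.act g a = x
    · obtain ⟨g, rfl⟩ := hx
      rw [h1, horb]
      exact hor
    · rw [h2 x hx]; exact hx
  have hψψ : ∀ x, ψ (ψ x) = ψ x := fun x => h2 _ (hψ x)
  have hψadj : ∀ x, ψ x ≠ x → T.graph.Adj x (ψ x) := by
    intro x hx
    by_cases hx' : ∃ g, T.act g a = x
    · obtain ⟨g, rfl⟩ := hx'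
      rw [h1]
      exact T.adj_act g _ _ hab
    · exact absurd (h2 x hx') hx
  let π : T.V → W := fun x => ⟨ψ x, hψ x⟩
  have hπ : ∀ z : W, π z.1 = z := fun z => Subtype.ext (h2 z.1 z.2)
  let X : SimpleGraph W :=
    { Adj := fun z w => z ≠ w ∧ ∃ p q, T.graph.Adj p q ∧ π p = z ∧ π q = w
      symm := ⟨by
        rintro z w ⟨hzw, p, q, h, e1, e2⟩
        exact ⟨hzw.symm, q, p, h.symm, e2, e1⟩⟩
      loopless := ⟨fun z h => h.1 rfl⟩ }
  let act : G →* Equiv.Perm W :=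
    { toFun := fun g =>
        { toFun := fun z => ⟨T.act g z.1, by rw [horb]; exact z.2⟩
          invFun := fun z => ⟨T.act g⁻¹ z.1, by rw [horb]; exact z.2⟩
          left_inv := fun z => Subtype.ext (by simp)
          right_inv := fun z => Subtype.ext (by simp) }
      map_one' := by ext z; simp
      map_mul' := by intro g h; ext z; simp }
  have hact : ∀ g (z : W), (act g z).1 = T.act g z.1 := fun g z => rfl
  have hπact : ∀ g x, π (T.act g x) = act g (π x) := fun g x => Subtype.ext (h3 g x)
  -- non-collapsed half-spaces
  have hN : ∀ {N : Set T.V} {p q : T.V}, Half T.graph N p q → π p ≠ π q →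
      ∀ z, ψ z ∈ N ↔ z ∈ N := by
    intro N p q hN hpq z
    by_cases hz : ψ z = z
    · rw [hz]
    constructor
    · intro e1
      by_contra e2
      obtain ⟨e3, e4⟩ := hN.2.2.2 _ _ (hψadj z hz).symm e1 e2
      apply hpq
      apply Subtype.ext
      change ψ p = ψ q
      rw [← e3, ← e4, hψψ]
    · intro e1
      by_contra e2
      obtain ⟨e3, e4⟩ := hN.2.2.2 _ _ (hψadj z hz) e1 e2
      apply hpq
      apply Subtype.ext
      change ψ p = ψ q
      rw [← e3, ← e4, hψψ]
  have hXN : ∀ {N : Set T.V} {p q : T.V}, Half T.graph N p q → π p ≠ π q →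
      Half X {z : W | z.1 ∈ N} (π p) (π q) := by
    intro N p q hpN hpq
    refine ⟨⟨hpq, p, q, hpN.1, rfl, rfl⟩, (hN hpN hpq p).2 hpN.2.1,
      fun h => hpN.2.2.1 ((hN hpN hpq q).1 h), ?_⟩
    rintro z w ⟨hzw, p', q', hpq', rfl, rfl⟩ hz hw
    obtain ⟨rfl, rfl⟩ := hpN.2.2.2 p' q' hpq' ((hN hpN hpq p').1 hz)
      (fun h => hw ((hN hpN hpq q').2 h))
    exact ⟨rfl, rfl⟩
  have hXc : X.Connected := by
    haveI : Nonempty W := ⟨π a⟩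
    have key : ∀ x y, T.graph.Reachable x y → X.Reachable (π x) (π y) := by
      rintro x y ⟨p⟩
      induction p with
      | nil => exact SimpleGraph.Reachable.refl _
      | @cons x y z h p ih =>
        refine SimpleGraph.Reachable.trans ?_ ih
        by_cases e : π x = π y
        · rw [e]
        · exact SimpleGraph.Adj.reachable ⟨e, x, y, h, rfl, rfl⟩
    refine ⟨fun z w => ?_⟩
    have := key z.1 w.1 (T.conn.preconnected _ _)
    rwa [hπ, hπ] at this
  let T' : GTree G := GTree.build W X hXc act (by
      rintro g z w ⟨hzw, p, q, hpq, rfl, rfl⟩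
      exact ⟨fun e => hzw ((act g).injective e), T.act g p, T.act g q, T.adj_act g _ _ hpq,
        hπact g p, hπact g q⟩) (by
      rintro g z w ⟨hzw, p, q, hpq, rfl, rfl⟩ ⟨e1, e2⟩
      obtain ⟨N, hpN⟩ := exists_half T.isTree hpq
      rw [← hπact] at e1 e2
      have e1' : ψ (T.act g p) = ψ q := congrArg Subtype.val e1
      have e2' : ψ (T.act g q) = ψ p := congrArg Subtype.val e2
      have f1 : T.act g p ∉ N := by
        rw [← hN hpN hzw, e1', hN hpN hzw]; exact hpN.2.2.1
      have f2 : T.act g q ∈ N := by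
        rw [← hN hpN hzw, e2', hN hpN hzw]; exact hpN.2.1
      obtain ⟨e3, e4⟩ := hpN.2.2.2 _ _ (T.adj_act g _ _ hpq).symm f2 f1
      exact T.noInversion g _ _ hpq ⟨e4, e3⟩) (by
      rintro z w ⟨hzw, p, q, hpq, rfl, rfl⟩
      obtain ⟨N, hpN⟩ := exists_half T.isTree hpq
      refine ⟨_, hXN hpN hzw, fun x => ?_⟩
      obtain ⟨g, hg⟩ := T.orbit_meets hpN x.1
      exact ⟨g, hg⟩)
  refine ⟨T', ?_, Subtype.val, Subtype.val_injective, ?_, fun g z => rfl, ?_⟩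
  · intro H
    constructor
    · rintro ⟨v, hv⟩
      refine ⟨π v, fun h hh => ?_⟩
      change act h (π v) = π v
      rw [← hπact, hv h hh]
    · rintro ⟨v, hv⟩
      exact ⟨v.1, fun h hh => congrArg Subtype.val (hv h hh)⟩
  · intro x
    constructor
    · rintro ⟨z, rfl⟩
      exact z.2
    · intro hx
      exact ⟨⟨x, hx⟩, rfl⟩
  · intro z w hzw
    refine ⟨fun e => hzw.ne (congrArg Subtype.val e), z.1, w.1, hzw, hπ z, hπ w⟩

end SlideSec


section RaySec

theorem ray_notMem {V : Type u} {X : SimpleGraph V} (hX : X.IsTree) (r : ℕ → V)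
    (hadj : ∀ n, X.Adj (r n) (r (n + 1))) (hnb : ∀ n, r (n + 2) ≠ r n) (m : ℕ) :
    ∀ (k : ℕ) (S : Set V), Half X S (r k) (r (k + 1)) → r (k + 1 + m) ∉ S := by
  induction m with
  | zero => exact fun k S h => h.2.2.1
  | succ m ih =>
    intro k S h hm
    obtain ⟨S', h'⟩ := exists_half hX (hadj (k + 1))
    have h1 := ih (k + 1) S' h'
    have e : k + 1 + 1 + m = k + 1 + (m + 1) := by omega
    rw [e] at h1
    -- use connectedness of the complementary half-space
    have key := h'.compl.const hX.connected (fun v => v ∈ S) (by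
      intro x y hxy hx hy hxS
      by_contra hyS
      obtain ⟨e1, e2⟩ := h.2.2.2 x y hxy hxS hyS
      rw [e2] at hy
      exact hy h'.2.1) _ h1
    have h2 : r (k + 1 + 1) ∈ S := key.1 hm
    have := (h.2.2.2 _ _ (hadj (k + 1)).symm h2 h.2.2.1).1
    exact hnb k this

theorem ray_inj {V : Type u} {X : SimpleGraph V} (hX : X.IsTree) (r : ℕ → V)
    (hadj : ∀ n, X.Adj (r n) (r (n + 1))) (hnb : ∀ n, r (n + 2) ≠ r n) :
    Function.Injective r := by
  have key : ∀ i j, i < j → r i ≠ r j := by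
    intro i j hij e
    obtain ⟨S, h⟩ := exists_half hX (hadj i)
    have := ray_notMem hX r hadj hnb (j - (i + 1)) i S h
    rw [show i + 1 + (j - (i + 1)) = j by omega, ← e] at this
    exact this h.2.1
  intro i j e
  rcases lt_trichotomy i j with h | h | h
  · exact absurd e (key i j h)
  · exact h
  · exact absurd e.symm (key j i h)

theorem ray_mem {V : Type u} {X : SimpleGraph V} (hX : X.IsTree) (r : ℕ → V)
    (hadj : ∀ n, X.Adj (r n) (r (n + 1))) (hnb : ∀ n, r (n + 2) ≠ r n) (m : ℕ)
    (S : Set V) (h : Half X S (r m) (r (m + 1))) (k : ℕ) : ∀ i ≤ m, i + k = m → r i ∈ S := by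
  induction k with
  | zero => intro i hi e; simp at e; subst e; exact h.2.1
  | succ k ih =>
    intro i hi e
    have h1 := ih (i + 1) (by omega) (by omega)
    by_contra hc
    have := (h.2.2.2 _ _ (hadj i).symm h1 hc).2
    have := ray_inj hX r hadj hnb this
    omega

variable {G : Type u} [Group G]

theorem axis (Y : GTree G) (t : G) (hyp : Y.Hyperbolic t) (P : Set Y.V) (hne : P.Nonempty)
    (hconv : ∀ u ∈ P, ∀ v ∈ P, ∀ p : Y.graph.Walk u v, p.IsPath → ∀ w ∈ p.support, w ∈ P)
    (hinv : ∀ x ∈ P, Y.act t x ∈ P) :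
    ∃ (L : ℕ) (r : ℕ → Y.V), 0 < L ∧ (∀ n, r n ∈ P) ∧ (∀ n, Y.graph.Adj (r n) (r (n + 1))) ∧
      (∀ n, r (n + 2) ≠ r n) ∧ ∀ n, r (n + L) = Y.act t (r n) := by
  have hex : ∃ d, ∃ x ∈ P, Y.graph.dist x (Y.act t x) = d := by
    obtain ⟨x, hx⟩ := hne
    exact ⟨_, x, hx, rfl⟩
  obtain ⟨x, hx, hL⟩ := Nat.find_spec hex
  have hmin : ∀ y ∈ P, Nat.find hex ≤ Y.graph.dist y (Y.act t y) := fun y hy =>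
    Nat.find_min' hex ⟨y, hy, rfl⟩
  generalize Nat.find hex = L at hL hmin
  obtain ⟨p, hp, hpl⟩ := Y.conn.exists_path_of_dist x (Y.act t x)
  rw [hL] at hpl
  have hLpos : 0 < L := by
    rcases Nat.eq_zero_or_pos L with h | h
    · subst h
      rw [Y.conn.dist_eq_zero_iff] at hL
      exact absurd hL.symm (hyp x)
    · exact h
  have hP : ∀ i, p.getVert i ∈ P := fun i =>
    hconv _ hx _ (hinv _ hx) p hp _ (p.getVert_mem_support i)
  have htP : ∀ q : ℕ, ∀ y ∈ P, Y.act (t ^ q) y ∈ P := by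
    intro q
    induction q with
    | zero => intro y hy; simpa using hy
    | succ q ih => intro y hy; rw [pow_succ', Y.act_mul]; exact hinv _ (ih y hy)
  let r : ℕ → Y.V := fun n => Y.act (t ^ (n / L)) (p.getVert (n % L))
  have hr0 : ∀ q m, m < L → r (q * L + m) = Y.act (t ^ q) (p.getVert m) := by
    intro q m hm
    have e1 : (q * L + m) / L = q := by
      rw [mul_comm, Nat.mul_add_div hLpos, Nat.div_eq_of_lt hm, add_zero]
    have e2 : (q * L + m) % L = m := by
      rw [mul_comm, Nat.mul_add_mod, Nat.mod_eq_of_lt hm]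
    simp only [r, e1, e2]
  have hend : p.getVert L = Y.act t x := by rw [← hpl, p.getVert_length]
  have hr : ∀ q m, m ≤ L → r (q * L + m) = Y.act (t ^ q) (p.getVert m) := by
    intro q m hm
    rcases hm.lt_or_eq with h | h
    · exact hr0 q m h
    · subst h
      have := hr0 (q + 1) 0 hLpos
      rw [show q * m + m = (q + 1) * m + 0 by ring, this, hend, p.getVert_zero, pow_succ,
        Y.act_mul]
  have hdec : ∀ n, ∃ q m, m < L ∧ n = q * L + m := fun n =>
    ⟨n / L, n % L, Nat.mod_lt _ hLpos, by rw [mul_comm]; exact (Nat.div_add_mod n L).symm⟩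
  refine ⟨L, r, hLpos, fun n => htP _ _ (hP _), ?_, ?_, ?_⟩
  · intro n
    obtain ⟨q, m, hm, rfl⟩ := hdec n
    rw [add_assoc, hr q m hm.le, hr q (m + 1) hm, Y.adj_act_iff]
    exact p.adj_getVert_succ (by omega)
  · intro n
    obtain ⟨q, m, hm, rfl⟩ := hdec n
    by_cases hm2 : m + 2 ≤ L
    · rw [add_assoc, hr q m hm.le, hr q (m + 2) hm2]
      intro e
      have := hp.getVert_injOn (by simp; omega) (by simp; omega) ((Y.act (t ^ q)).injective e)
      omega
    · have hm3 : L = m + 1 := by omega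
      rw [hr q m hm.le, show q * L + m + 2 = (q + 1) * L + 1 by rw [hm3]; ring, hr _ 1 hLpos,
        pow_succ, Y.act_mul]
      intro e
      have e := (Y.act (t ^ q)).injective e
      rcases Nat.eq_zero_or_pos m with h0 | h0
      · subst h0
        have h1 : p.getVert 1 = Y.act t x := by rw [hm3] at hend; exact hend
        rw [p.getVert_zero, h1] at e
        refine Y.noInversion t x (Y.act t x) ?_ ⟨rfl, e⟩
        have := p.adj_getVert_succ (i := 0) (by omega)
        rwa [p.getVert_zero, h1] at this
      · have h1 := hmin _ (hP 1)
        rw [e] at h1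
        have h2 : Y.graph.dist (p.getVert 1) (p.getVert m) ≤ m - 1 := by
          have hw := SimpleGraph.dist_le ((p.drop 1).take (m - 1))
          have hlen : ((p.drop 1).take (m - 1)).length ≤ m - 1 := by
            simp
          have e3 : (p.drop 1).getVert (m - 1) = p.getVert m := by
            rw [SimpleGraph.Walk.drop_getVert]; congr 1; omega
          rw [← e3]
          omega
        omega
  · intro n
    obtain ⟨q, m, hm, rfl⟩ := hdec n
    rw [show q * L + m + L = (q + 1) * L + m by ring, hr _ _ hm.le, hr _ _ hm.le, pow_succ',
      Y.act_mul]

theorem pow_ray {Y : GTree G} {t : G} {L : ℕ} {r : ℕ → Y.V}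
    (hr : ∀ n, r (n + L) = Y.act t (r n)) (i n : ℕ) : Y.act (t ^ i) (r n) = r (n + i * L) := by
  induction i with
  | zero => simp
  | succ i ih => rw [pow_succ', Y.act_mul, ih, ← hr]; congr 1; ring

theorem dir (Y : GTree G) (t : G) {L : ℕ} {r : ℕ → Y.V} (hL : 0 < L)
    (hadj : ∀ n, Y.graph.Adj (r n) (r (n + 1))) (hnb : ∀ n, r (n + 2) ≠ r n)
    (hr : ∀ n, r (n + L) = Y.act t (r n)) {S : Set Y.V} (hS : Half Y.graph S (r 0) (r 1))
    (q : Y.V) : ∃ i0 : ℕ, ∀ i ≥ i0, Y.act (t ^ i)⁻¹ q ∈ S ∧ Y.act (t ^ i) q ∉ S := by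
  have inj := ray_inj Y.isTree r hadj hnb
  have nofix : ∀ n i j, Y.act (t ^ i) (r n) = Y.act (t ^ j) (r n) → i = j := by
    intro n i j e
    rw [pow_ray hr, pow_ray hr] at e
    have := inj e
    exact Nat.eq_of_mul_eq_mul_right hL (by omega)
  obtain ⟨p⟩ := Y.conn.preconnected q (r 0)
  have hb : ∀ x y, ∃ i0 : ℕ, ∀ i ≥ i0, Y.act (t ^ i)⁻¹ x ≠ r 0 ∧ Y.act (t ^ i) y ≠ r 1 := by
    intro x y
    have h1 : ∃ i0 : ℕ, ∀ i ≥ i0, Y.act (t ^ i)⁻¹ x ≠ r 0 := by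
      by_contra hc
      push Not at hc
      obtain ⟨i, -, hi⟩ := hc 0
      obtain ⟨j, hj, hj'⟩ := hc (i + 1)
      rw [Y.act_eq_iff, inv_inv] at hi hj'
      have := nofix 0 i j (by rw [← hi, ← hj'])
      omega
    have h2 : ∃ i0 : ℕ, ∀ i ≥ i0, Y.act (t ^ i) y ≠ r 1 := by
      by_contra hc
      push Not at hc
      obtain ⟨i, -, hi⟩ := hc 0
      obtain ⟨j, hj, hj'⟩ := hc (i + 1)
      have : Y.act (t ^ (j - i)) (r 1) = Y.act (t ^ 0) (r 1) := by
        conv_lhs => rw [← hi]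
        rw [← Y.act_mul, ← pow_add, show j - i + i = j by omega, hj']
        simp
      have := nofix 1 _ _ this
      omega
    obtain ⟨i, hi⟩ := h1
    obtain ⟨j, hj⟩ := h2
    exact ⟨max i j, fun k hk => ⟨hi k (le_trans (le_max_left _ _) hk),
      hj k (le_trans (le_max_right _ _) hk)⟩⟩
  generalize hz : r 0 = z at p
  induction p with
  | nil =>
    subst hz
    refine ⟨1, fun i hi => ⟨?_, ?_⟩⟩
    · have h := Y.half_translate (t ^ i) hS
      rw [pow_ray hr, pow_ray hr, show 1 + i * L = (0 + i * L) + 1 by ring] at h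
      exact ray_mem Y.isTree r hadj hnb _ _ h (i * L) 0 (by omega) (by omega)
    · rw [pow_ray hr]
      have := ray_notMem Y.isTree r hadj hnb (i * L - 1) 0 S hS
      rwa [show 0 + 1 + (i * L - 1) = 0 + i * L by
        have : 0 < i * L := Nat.mul_pos hi hL
        omega] at this
  | @cons a b _ hab p ih =>
    obtain ⟨i0, hi0⟩ := ih hz
    obtain ⟨i1, hi1⟩ := hb b b
    refine ⟨max i0 i1, fun i hi => ?_⟩
    obtain ⟨h1, h2⟩ := hi0 i (le_trans (le_max_left _ _) hi)
    obtain ⟨h3, h4⟩ := hi1 i (le_trans (le_max_right _ _) hi)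
    constructor
    · by_contra hc
      exact h3 (hS.2.2.2 _ _ (Y.adj_act _ _ _ hab.symm) h1 hc).1
    · intro hc
      exact h4 (hS.2.2.2 _ _ (Y.adj_act _ _ _ hab) hc h2).2

theorem hyp_of_ray (Y : GTree G) (t : G) {L : ℕ} {r : ℕ → Y.V} (hL : 0 < L)
    (hadj : ∀ n, Y.graph.Adj (r n) (r (n + 1))) (hnb : ∀ n, r (n + 2) ≠ r n)
    (hr : ∀ n, r (n + L) = Y.act t (r n)) : Y.Hyperbolic t := by
  intro q e
  obtain ⟨S, hS⟩ := exists_half Y.isTree (hadj 0)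
  obtain ⟨i, hi⟩ := dir Y t hL hadj hnb hr hS q
  obtain ⟨h1, h2⟩ := hi i le_rfl
  have e1 : Y.act (t ^ i) q = q := Subgroup.pow_mem (Y.stab q) e i
  have e2 : Y.act (t ^ i)⁻¹ q = q := (Y.stab q).inv_mem (Subgroup.pow_mem (Y.stab q) e i)
  rw [e1] at h2
  rw [e2] at h1
  exact h2 h1

theorem hyp_same {T T' : GTree G} (h : SameDef T T') (g : G) (hg : T.Hyperbolic g) :
    T'.Hyperbolic g := by
  intro v hv
  obtain ⟨w, hw⟩ := (h (Subgroup.zpowers g)).2 ⟨v, by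
    have : Subgroup.zpowers g ≤ T'.stab v := by
      rw [Subgroup.zpowers_le]; exact hv
    exact this⟩
  exact hg w (hw g (Subgroup.mem_zpowers g))

theorem path_fixed (Y : GTree G) (g : G) {x y : Y.V} (hx : Y.act g x = x) (hy : Y.act g y = y)
    (p : Y.graph.Walk x y) (hp : p.IsPath) (w : Y.V) (hw : w ∈ p.support) : Y.act g w = w := by
  let f : Y.graph →g Y.graph := ⟨fun v => Y.act g v, fun {a b} h => Y.adj_act g a b h⟩
  have hf : Function.Injective f := (Y.act g).injective
  let p' : Y.graph.Walk x y := (p.map f).copy hx hy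
  have hp' : p'.IsPath := by
    simp only [p', SimpleGraph.Walk.isPath_copy]
    exact SimpleGraph.Walk.map_isPath_of_injective hf hp
  have e : p' = p := by
    have := Y.isTree.isAcyclic.path_unique ⟨p', hp'⟩ ⟨p, hp⟩
    exact congrArg Subtype.val this
  have hs : p.support.map f = p.support := by
    conv_rhs => rw [← e]
    simp [p']
  obtain ⟨i, hi, rfl⟩ := List.mem_iff_getElem.1 hw
  have := List.getElem_of_eq hs (i := i) (by simpa using hi)
  rw [List.getElem_map] at this
  exact this

theorem fix_ray {T Y : GTree G} (hTY : SameDef T Y) (t : G) (u : T.V) (hyp : T.Hyperbolic t)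
    (hle : T.stab u ≤ T.stab (T.act t u)) :
    ∃ (L : ℕ) (r : ℕ → Y.V), 0 < L ∧ (∀ n, ∀ h ∈ T.stab u, Y.act h (r n) = r n) ∧
      (∀ n, Y.graph.Adj (r n) (r (n + 1))) ∧
      (∀ n, r (n + 2) ≠ r n) ∧ ∀ n, r (n + L) = Y.act t (r n) := by
  obtain ⟨y, hy⟩ := (hTY (T.stab u)).1 ⟨u, fun h hh => hh⟩
  exact axis Y t (hyp_same hTY t hyp) {z | ∀ h ∈ T.stab u, Y.act h z = z} ⟨y, hy⟩
    (fun a ha b hb p hp w hw h hh => path_fixed Y h (ha h hh) (hb h hh) p hp w hw)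
    (by
      intro x hx h hh
      have h1 := hle hh
      rw [T.mem_stab_act] at h1
      have := hx _ h1
      rw [Y.act_mul, Y.act_mul, Y.act_eq_iff, inv_inv] at this
      exact this)

end RaySec


section CaseSec
variable {G : Type u} [Group G]

/-- A strict ascending loop, oriented. -/
structure SAL (T : GTree G) (u : T.V) (t : G) : Prop where
  adj : T.graph.Adj u (T.act t u)
  le : T.stab u ≤ T.stab (T.act t u)
  nle : ¬ T.stab (T.act t u) ≤ T.stab u

theorem SAL.has {T : GTree G} {u : T.V} {t : G} (h : SAL T u t) : HasSAL T :=
  ⟨u, T.act t u, h.adj, ⟨t, rfl⟩, Or.inl ⟨h.le, h.nle⟩⟩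

theorem HasSAL.ex {T : GTree G} (h : HasSAL T) : ∃ u t, SAL T u t := by
  obtain ⟨u, v, hadj, ⟨t, rfl⟩, ⟨h1, h2⟩ | ⟨h1, h2⟩⟩ := h
  · exact ⟨u, t, hadj, h1, h2⟩
  · refine ⟨T.act t u, t⁻¹, ?_, ?_, ?_⟩ <;> rw [T.act_inv_act]
    · exact hadj.symm
    · exact h1
    · exact h2

namespace SAL
variable {T : GTree G} {u : T.V} {t : G}

theorem ray_adj (h : SAL T u t) (n : ℕ) : T.graph.Adj (T.act (t ^ n) u) (T.act (t ^ (n + 1)) u) := by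
  rw [pow_succ, T.act_mul, T.adj_act_iff]
  exact h.adj

theorem ray_nb (h : SAL T u t) (n : ℕ) : T.act (t ^ (n + 2)) u ≠ T.act (t ^ n) u := by
  rw [pow_add, T.act_mul]
  intro e
  have e := (T.act (t ^ n)).injective e
  rw [pow_two, T.act_mul] at e
  exact T.noInversion t _ _ h.adj ⟨rfl, e⟩

theorem ray_t (n : ℕ) : T.act (t ^ (n + 1)) u = T.act t (T.act (t ^ n) u) := by
  rw [pow_succ', T.act_mul]

theorem hyp (h : SAL T u t) : T.Hyperbolic t :=
  hyp_of_ray T t (r := fun n => T.act (t ^ n) u) one_pos h.ray_adj h.ray_nb (fun n => ray_t n)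

theorem stab_le_pow (h : SAL T u t) (n : ℕ) : T.stab u ≤ T.stab (T.act (t ^ n) u) := by
  induction n with
  | zero => simp
  | succ n ih =>
    intro g hg
    have h1 := ih hg
    rw [T.mem_stab_act] at h1
    have := h.le h1
    rw [pow_succ, T.act_mul, T.mem_stab_act]
    exact this

theorem ne_one (h : SAL T u t) : ∃ g ∈ T.stab u, g ≠ 1 := by
  by_contra hc
  push Not at hc
  apply h.nle
  intro g hg
  rw [T.mem_stab_act] at hg
  have := hc _ hg
  have : g = 1 := by
    have h2 : g = t * (t⁻¹ * g * t) * t⁻¹ := by group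
    rw [h2, this]; group
  rw [this]; exact Subgroup.one_mem _

theorem case2 (h : SAL T u t) {Y : GTree G} (hTY : SameDef T Y)
    (hY : ∀ g : G, g ≠ 1 →
        ¬∃ r : ℕ → Y.V, (∀ n : ℕ, Y.graph.Adj (r n) (r (n + 1))) ∧
          Function.Injective r ∧ ∀ n : ℕ, Y.act g (r n) = r n) : False := by
  obtain ⟨L, r, hL, hf, hadj, hnb, hr⟩ := fix_ray hTY t u h.hyp h.le
  obtain ⟨g, hg, hg1⟩ := h.ne_one
  exact hY g hg1 ⟨r, hadj, ray_inj Y.isTree r hadj hnb, fun n => hf n g hg⟩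

theorem case3 (h : SAL T u t) (hA : ∀ g : G,
        (∀ x ∈ T.stab u, g * x * g⁻¹ ∈ T.stab u) → ∀ x ∈ T.stab u, g⁻¹ * x * g ∈ T.stab u) :
    False := by
  apply h.nle
  intro g hg
  rw [T.mem_stab_act] at hg
  have := hA t⁻¹ (by
    intro x hx
    have := h.le hx
    rw [T.mem_stab_act] at this
    rwa [inv_inv]) _ hg
  rw [inv_inv] at this
  have e : t * (t⁻¹ * g * t) * t⁻¹ = g := by group
  rwa [e] at this

theorem amin (h : SAL T u t) : Amin T (T.stab u) := by
  intro Y hTY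
  obtain ⟨L, r, hL, hf, hadj, hnb, hr⟩ := fix_ray hTY t u h.hyp h.le
  exact ⟨r 0, r 1, hadj 0, fun g hg => ⟨hf 0 g hg, hf 1 g hg⟩⟩

end SAL

theorem SameDef.symm' {T T' : GTree G} (h : SameDef T T') : SameDef T' T := fun H => (h H).symm
theorem SameDef.trans' {T T' T'' : GTree G} (h : SameDef T T') (h' : SameDef T' T'') :
    SameDef T T'' := fun H => (h H).trans (h' H)

theorem conv_of_walks {V : Type u} {X : SimpleGraph V} (hX : X.IsTree) (P : Set V)
    (hP : ∀ x ∈ P, ∀ y ∈ P, ∃ p : X.Walk x y, ∀ w ∈ p.support, w ∈ P) :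
    ∀ x ∈ P, ∀ y ∈ P, ∀ p : X.Walk x y, p.IsPath → ∀ w ∈ p.support, w ∈ P := by
  intro x hx y hy p hp w hw
  obtain ⟨q, hq⟩ := hP x hx y hy
  have hsub : Subsingleton (X.Path x y) := hX.isAcyclic.subsingleton_path x y
  have e : q.toPath = (⟨p, hp⟩ : X.Path x y) := Subsingleton.elim _ _
  apply hq
  apply q.support_toPath_subset_support
  rw [e]
  exact hw

theorem exists_cover [Group.FG G] (T : GTree G) : ∃ F : Finset T.V, ∀ x, ∃ g : G, T.act g x ∈ F := by
  obtain ⟨S, hS⟩ := (Group.fg_def.1 (inferInstance : Group.FG G))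
  obtain ⟨v⟩ := T.nonempty
  have hp : ∀ s : G, ∃ p : T.graph.Walk v (T.act s v), True := by
    intro s
    obtain ⟨p⟩ := T.conn.preconnected v (T.act s v)
    exact ⟨p, trivial⟩
  choose p hp using hp
  let F : Finset T.V := {v} ∪ S.biUnion (fun s => (p s).support.toFinset)
  have hvF : v ∈ F := by simp [F]
  refine ⟨F, ?_⟩
  let P : Set T.V := {x | ∃ g : G, T.act g x ∈ F}
  have hinv : ∀ (g : G), ∀ x ∈ P, T.act g x ∈ P := by
    rintro g x ⟨k, hk⟩
    exact ⟨k * g⁻¹, by rw [← T.act_mul]; simpa using hk⟩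
  -- joined within P
  let J : T.V → T.V → Prop := fun x y => ∃ q : T.graph.Walk x y, ∀ w ∈ q.support, w ∈ P
  have Jsymm : ∀ x y, J x y → J y x := by
    rintro x y ⟨q, hq⟩
    exact ⟨q.reverse, by simpa using hq⟩
  have Jtrans : ∀ x y z, J x y → J y z → J x z := by
    rintro x y z ⟨q, hq⟩ ⟨q', hq'⟩
    refine ⟨q.append q', fun w hw => ?_⟩
    rw [SimpleGraph.Walk.mem_support_append_iff] at hw
    exact hw.elim (hq w) (hq' w)
  have Jact : ∀ (g : G) x y, J x y → J (T.act g x) (T.act g y) := by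
    rintro g x y ⟨q, hq⟩
    let f : T.graph →g T.graph := ⟨fun v => T.act g v, fun {a b} h => T.adj_act g a b h⟩
    refine ⟨q.map f, fun w hw => ?_⟩
    rw [SimpleGraph.Walk.support_map, List.mem_map] at hw
    obtain ⟨z, hz, rfl⟩ := hw
    exact hinv g z (hq z hz)
  have hFP : ∀ x ∈ F, x ∈ P := fun x hx => ⟨1, by simpa using hx⟩
  have Jgen : ∀ s ∈ S, J v (T.act s v) := by
    intro s hs
    refine ⟨p s, fun w hw => hFP w ?_⟩
    simp only [F, Finset.mem_union, Finset.mem_biUnion, List.mem_toFinset]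
    exact Or.inr ⟨s, hs, hw⟩
  have Jrefl : ∀ x ∈ P, J x x := fun x hx => ⟨SimpleGraph.Walk.nil, by simpa using hx⟩
  have Jall : ∀ g : G, J v (T.act g v) := by
    intro g
    have hg : g ∈ Subgroup.closure (S : Set G) := by rw [hS]; trivial
    induction hg using Subgroup.closure_induction with
    | mem s hs => exact Jgen s hs
    | one => simpa using Jrefl v (hFP v hvF)
    | mul a b _ _ ha hb =>
      rw [T.act_mul]
      exact Jtrans _ _ _ ha (Jact a _ _ hb)
    | inv a _ ha =>
      have := Jact a⁻¹ _ _ ha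
      rw [T.act_inv_act] at this
      exact Jsymm _ _ this
  have JF : ∀ x ∈ F, J v x := by
    intro x hx
    have hx' := hx
    simp only [F, Finset.mem_union, Finset.mem_biUnion, List.mem_toFinset,
      Finset.mem_singleton] at hx'
    rcases hx' with rfl | ⟨s, hs, hx'⟩
    · exact Jrefl _ (hFP _ hx)
    · refine ⟨(p s).takeUntil x hx', fun w hw => hFP w ?_⟩
      simp only [F, Finset.mem_union, Finset.mem_biUnion, List.mem_toFinset]
      exact Or.inr ⟨s, hs, (p s).support_takeUntil_subset_support hx' hw⟩
  have JP : ∀ x ∈ P, J v x := by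
    rintro x ⟨g, hg⟩
    have := Jact g⁻¹ _ _ (JF _ hg)
    rw [T.act_inv_act] at this
    exact Jtrans _ _ _ (Jall _) this
  have := T.minimal P ⟨v, hFP v hvF⟩ hinv (conv_of_walks T.isTree P (fun x hx y hy =>
    Jtrans _ _ _ (Jsymm _ _ (JP x hx)) (JP y hy)))
  intro x
  have hx : x ∈ P := by rw [this]; trivial
  exact hx

theorem SAL.stab_lt {T : GTree G} {u : T.V} {t : G} (h : SAL T u t) (g : G)
    (hle : T.stab (T.act (g * t) u) ≤ T.stab (T.act g u)) : False := by
  apply h.nle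
  intro k hk
  have h1 : g * k * g⁻¹ ∈ T.stab (T.act (g * t) u) := by
    rw [T.mem_stab_act]
    rw [T.mem_stab_act] at hk
    have e : (g * t)⁻¹ * (g * k * g⁻¹) * (g * t) = t⁻¹ * k * t := by group
    rwa [e]
  have h2 := hle h1
  rw [T.mem_stab_act] at h2
  have e : g⁻¹ * (g * k * g⁻¹) * g = k := by group
  rwa [e] at h2

theorem case1_aux (T₀ : GTree G) (h0 : ∀ T : GTree G, SameDef T₀ T → T.Reduced → ¬HasSAL T)
    (n : ℕ) : ∀ (T : GTree G) (_ : SameDef T₀ T) (F : Finset T.V) (_ : F.card = n)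
      (_ : ∀ x, ∃ g : G, T.act g x ∈ F), ¬ HasSAL T := by
  induction n using Nat.strong_induction_on with
  | _ n ih =>
  intro T hT F hF hcov hsal
  obtain ⟨u, t, h⟩ := hsal.ex
  obtain ⟨φ, hs, hφ, hφ'⟩ := exists_slideD T u t h.adj h.le
  have hφu : φ u = T.act t u := by simpa using hφ 1
  let T1 := hs.slide 1
  have hT1 : SameDef T₀ T1 := hT.trans' (hs.slide_sameDef 1)
  have h1 : SAL T1 u t := by
    refine ⟨?_, h.le, h.nle⟩
    exact ⟨h.adj.ne, Or.inl hφu.symm⟩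
  by_cases hred : T1.Reduced
  · exact h0 T1 hT1 hred h1.has
  · unfold GTree.Reduced at hred
    push Not at hred
    obtain ⟨a, b, hab, hle, hor⟩ := hred
    change ∀ g, T.act g a ≠ b at hor
    have hau : ∀ g, T.act g u ≠ a := by
      rintro g rfl
      obtain ⟨hne, e | e | ⟨p, q, hpq, e1, e2⟩⟩ := hab
      · rw [hφ] at e
        apply hor (g * t * g⁻¹)
        rw [← T.act_mul, e]; congr 2; group
      · have : ∃ k, T.act k u = b := by
          refine (hφ' b).1 ?_
          intro e'
          exact hne (e.trans e')
        obtain ⟨k, rfl⟩ := this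
        apply hor (k * g⁻¹)
        rw [← T.act_mul]; congr 2; group
      · simp only [Function.iterate_one] at e1 e2
        have hp : φ p ≠ p := by
          intro e
          have h2 := (hφ' (T.act g u)).2 ⟨g, rfl⟩
          rw [← e1, e] at h2
          exact h2 e
        obtain ⟨k, rfl⟩ := (hφ' p).1 hp
        apply h.stab_lt k
        intro z hz
        have hz1 : z ∈ T.stab (φ (T.act k u)) := by rw [hφ]; exact hz
        rw [e1] at hz1
        have hz2 : T.act z b = b := hle hz1
        exact (hs.ne_rigid 1 z hpq (by
          simp only [Function.iterate_one]
          rw [hs.eqv, e1]; exact hz1) (by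
          simp only [Function.iterate_one]
          rw [hs.eqv, e2]; exact hz2)).1
    obtain ⟨T2, hT2, ι, hinj, hran, heq, hadj⟩ := exists_collapse T1 a b hab hle
      (by rintro ⟨g, hg⟩; exact hor g hg)
    have hO : ∀ g, ∃ z, ι z = T.act g u := by
      intro g
      refine (hran _).2 ?_
      rintro ⟨k, hk⟩
      apply hau (k⁻¹ * g)
      change T.act k a = T.act g u at hk
      rw [T.act_mul, ← hk]
      exact T.act_inv_act k a
    obtain ⟨u', hu'⟩ := hO 1
    rw [T.act_one] at hu'
    have hst : ∀ z, T2.stab z = T1.stab (ι z) := by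
      intro z
      ext g
      rw [T2.mem_stab, T1.mem_stab, ← heq]
      exact ⟨fun e => by rw [e], fun e => hinj e⟩
    have h2 : SAL T2 u' t := by
      refine ⟨?_, ?_, ?_⟩
      · apply hadj
        rw [heq, hu']; exact h1.adj
      · rw [hst, hst, heq, hu']; exact h1.le
      · rw [hst, hst, heq, hu']; exact h1.nle
    let F1 : Finset T1.V := F
    have hF1 : F1.card = n := hF
    have hcov1 : ∀ x : T1.V, ∃ g : G, T1.act g x ∈ F1 := hcov
    let F2 : Finset T2.V := F1.preimage ι hinj.injOn
    refine ih F2.card ?_ T2 (hT1.trans' hT2) F2 rfl ?_ h2.has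
    · rw [← hF1]
      obtain ⟨g, hg⟩ := hcov1 a
      rw [← Finset.card_image_of_injective F2 hinj]
      apply Finset.card_lt_card
      rw [Finset.ssubset_iff_of_subset]
      · refine ⟨_, hg, ?_⟩
        simp only [Finset.mem_image, not_exists, not_and]
        intro z _ hz
        exact (hran _).1 ⟨z, hz⟩ ⟨g, rfl⟩
      · intro x hx
        simp only [Finset.mem_image, F2, Finset.mem_preimage] at hx
        obtain ⟨z, hz, rfl⟩ := hx
        exact hz
    · intro z
      obtain ⟨g, hg⟩ := hcov1 (ι z)
      refine ⟨g, ?_⟩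
      simp only [F2, Finset.mem_preimage]
      rw [heq]
      exact hg

end CaseSec


section Case4
variable {G : Type u} [Group G]

theorem iter_u {T : GTree G} {u : T.V} {t : G} {φ : T.V → T.V}
    (hφ : ∀ g, φ (T.act g u) = T.act (g * t) u) (g : G) (n : ℕ) :
    φ^[n] (T.act g u) = T.act (g * t ^ n) u := by
  induction n with
  | zero => simp
  | succ n ih => rw [Function.iterate_succ_apply', ih, hφ, pow_succ, mul_assoc]

theorem exists_NE_edge {T : GTree G} (hirr : T.Irred) {u : T.V} {t : G} {φ : T.V → T.V}
    (hs : SlideD T φ) (hφ : ∀ g, φ (T.act g u) = T.act (g * t) u)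
    (hφ' : ∀ x, φ x ≠ x ↔ ∃ g, T.act g u = x) : ∃ w, NE T φ u w := by
  by_contra hc
  push Not at hc
  have h1 : ∀ g b, ¬ NE T φ (T.act g u) b := by
    intro g b hb
    have := hs.ne_act g⁻¹ hb
    rw [T.act_inv_act] at this
    exact hc _ this
  have h2 : ∀ x, ∀ p : T.graph.Walk x u, (∃ g, T.act g u = x) ∧ ∃ a b, φ^[a] x = φ^[b] u := by
    intro x p
    generalize hz : u = z at p
    induction p with
    | nil => subst hz; exact ⟨⟨1, by simp⟩, 0, 0, rfl⟩
    | @cons x y _ hxy p ih =>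
      obtain ⟨⟨g, hg⟩, a, b, hab⟩ := ih hz
      subst hz
      have hn := h1 g x
      rw [hg] at hn
      by_cases e1 : x = φ y
      · refine ⟨⟨g * t, by rw [e1, ← hg, hφ]⟩, a, b + 1, ?_⟩
        rw [e1, ← Function.iterate_succ_apply, Function.iterate_succ_apply', hab,
          Function.iterate_succ_apply']
      · have e2 : y = φ x := by
          by_contra e2
          exact hn ⟨hxy.symm, e1, e2⟩
        refine ⟨(hφ' x).1 ?_, a + 1, b, ?_⟩
        · rw [← e2]; exact hxy.ne'
        · rw [Function.iterate_succ_apply, ← e2, hab]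
  have R : ∀ g, ∃ a b, φ^[a] (T.act g u) = φ^[b] u := by
    intro g
    obtain ⟨p⟩ := T.conn.preconnected (T.act g u) u
    exact (h2 _ p).2
  have Rm : ∀ g h a b c d, φ^[a] (T.act g u) = φ^[b] u → φ^[c] (T.act h u) = φ^[d] u →
      φ^[a + c] (T.act (g * h) u) = φ^[b + d] u := by
    intro g h a b c d e1 e2
    rw [Function.iterate_add_apply, T.act_mul, hs.eqv_iter, e2, ← hs.eqv_iter,
      ← Function.iterate_add_apply, add_comm a d, Function.iterate_add_apply, e1,
      ← Function.iterate_add_apply, add_comm]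
  have Ri : ∀ g a b, φ^[a] (T.act g u) = φ^[b] u → φ^[b] (T.act g⁻¹ u) = φ^[a] u := by
    intro g a b e
    rw [hs.eqv_iter, ← e, ← hs.eqv_iter, T.act_inv_act]
  obtain ⟨g, h, -, -, hyp⟩ := hirr
  obtain ⟨a, b, e1⟩ := R g
  obtain ⟨c, d, e2⟩ := R h
  have := Rm _ _ _ _ _ _ (Rm _ _ _ _ _ _ (Rm _ _ _ _ _ _ e1 e2) (Ri _ _ _ e1)) (Ri _ _ _ e2)
  rw [hs.eqv_iter, show b + d + a + c = a + c + b + d by ring] at this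
  exact hyp _ this

theorem exists_mover {T Y : GTree G} (hTY : SameDef T Y) {u : T.V} {t : G} (h : SAL T u t)
    {L : ℕ} {r : ℕ → Y.V} (hf : ∀ n, ∀ h ∈ T.stab u, Y.act h (r n) = r n)
    (hr : ∀ n, r (n + L) = Y.act t (r n)) :
    ∃ j g m, g ∈ T.stab (T.act (t ^ j) u) ∧ Y.act g (r (m + 1)) = r (m + 1) ∧
      Y.act g (r m) ≠ r m := by
  have h0 : ∃ j g, g ∈ T.stab (T.act (t ^ j) u) ∧ Y.act g (r 0) ≠ r 0 := by
    by_contra hc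
    push Not at hc
    obtain ⟨y, hy⟩ := (hTY (Y.stab (r 0))).2 ⟨r 0, fun g hg => hg⟩
    obtain ⟨k, hk, hk'⟩ := SetLike.not_le_iff_exists.1 h.nle
    obtain ⟨B, hB⟩ := exists_half T.isTree h.adj
    obtain ⟨j, hj⟩ := dir T t (r := fun n => T.act (t ^ n) u) one_pos h.ray_adj h.ray_nb
      (fun n => SAL.ray_t n) (S := B) (by simpa using hB) y
    have h1 := (hj j le_rfl).1
    have h2 := T.moveHalf hB k hk hk' _ h1
    have h3 : t ^ j * k * (t ^ j)⁻¹ ∈ Y.stab (r 0) := by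
      apply hc (j + 1)
      rw [pow_succ, T.act_mul, T.mem_stab_act]
      have e : (t ^ j)⁻¹ * (t ^ j * k * (t ^ j)⁻¹) * t ^ j = k := by group
      rw [e]; exact hk
    have h4 := hy _ h3
    rw [mul_assoc, T.act_mul, T.act_eq_iff, T.act_mul] at h4
    rw [h4] at h2
    exact h2 h1
  obtain ⟨j, g, hg, hne⟩ := h0
  have hex : ∃ n, Y.act g (r n) = r n := by
    refine ⟨0 + j * L, ?_⟩
    rw [← pow_ray hr]
    rw [T.mem_stab_act] at hg
    have := hf 0 _ hg
    rw [Y.act_mul, Y.act_mul, Y.act_eq_iff, inv_inv] at this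
    exact this
  obtain ⟨m, hm⟩ : ∃ m, Nat.find hex = m + 1 := by
    refine Nat.exists_eq_succ_of_ne_zero ?_
    intro e
    have := Nat.find_spec hex
    rw [e] at this
    exact hne this
  refine ⟨j, g, m, hg, ?_, ?_⟩
  · rw [← hm]; exact Nat.find_spec hex
  · exact Nat.find_min hex (by omega)

theorem exists_sep {T : GTree G} {u : T.V} {t : G} (h : SAL T u t) {φ : T.V → T.V}
    (hs : SlideD T φ) (hφ : ∀ g, φ (T.act g u) = T.act (g * t) u) {w : T.V} (hne : NE T φ u w)
    {N : Set T.V} (hN : Half T.graph N u w) : ∃ s : G, ∀ z ∈ N, T.act s z ∉ N := by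
  obtain ⟨ρ, hρ⟩ := T.orbit_meets hN.compl u
  have hρ : T.act ρ u ∉ N := hρ
  have hpos : ∀ i : ℕ, T.act (ρ * t ^ i) u ∉ N := by
    intro i
    rw [← iter_u hφ, hs.ne_mem_iter i hN hne]
    exact hρ
  have hneg : ∀ i : ℕ, T.act (ρ * (t ^ i)⁻¹) u ∉ N := by
    intro i
    rw [← hs.ne_mem_iter i hN hne, iter_u hφ, inv_mul_cancel_right]
    exact hρ
  have hpow : ∀ i : ℕ, (ρ * t * ρ⁻¹) ^ i = ρ * t ^ i * ρ⁻¹ := fun i => conj_pow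
  have hR : ∀ n, T.act (ρ * t ^ n) u = T.act ρ (T.act (t ^ n) u) := fun n => T.act_mul _ _ _
  have hadj : ∀ n, T.graph.Adj (T.act (ρ * t ^ n) u) (T.act (ρ * t ^ (n + 1)) u) := by
    intro n
    rw [hR, hR, T.adj_act_iff]; exact h.ray_adj n
  obtain ⟨S, hS⟩ := exists_half T.isTree (hadj 0)
  obtain ⟨i, hi⟩ := dir T (ρ * t * ρ⁻¹) (r := fun n => T.act (ρ * t ^ n) u) one_pos hadj
    (fun n e => h.ray_nb n (by
      rw [hR, hR] at e; exact (T.act ρ).injective e))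
    (by
      intro n
      rw [← T.act_mul]
      congr 2
      rw [pow_succ']; group) hS u
  obtain ⟨h1, h2⟩ := hi i le_rfl
  generalize hs0 : (ρ * t * ρ⁻¹) ^ i = s0 at h1 h2
  have hs0' : s0 = ρ * t ^ i * ρ⁻¹ := by rw [← hs0, hpow]
  have k1 : ∀ z ∈ N, T.act s0⁻¹ z ∈ S := by
    intro z hz
    have hA := T.half_translate s0 hS
    refine (hN.const T.conn (fun v => v ∈ {x | T.act s0⁻¹ x ∈ S}) ?_ z hz).2 h1
    intro x y hxy hx hy hxA
    by_contra hyA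
    have := (hA.2.2.2 x y hxy hxA hyA).1
    rw [this, ← T.act_mul, hs0'] at hx
    apply hpos i
    convert hx using 3
    group
  have k2 : ∀ z ∈ N, T.act s0 z ∉ S := by
    intro z hz hzS
    have hA := T.half_translate s0⁻¹ hS
    rw [inv_inv] at hA
    refine h2 ((hN.const T.conn (fun v => v ∈ {x | T.act s0 x ∈ S}) ?_ z hz).1 hzS)
    intro x y hxy hx hy hxA
    by_contra hyA
    have := (hA.2.2.2 x y hxy hxA hyA).1
    rw [this, ← T.act_mul, hs0'] at hx
    apply hneg i
    convert hx using 3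
    group
  refine ⟨s0 * s0, fun z hz hsz => ?_⟩
  have := k1 _ hsz
  rw [T.act_mul, T.act_inv_act] at this
  exact k2 z hz this

theorem slide_D {T : GTree G} {φ : T.V → T.V} (hs : SlideD T φ) (n m : ℕ) {x a b : T.V}
    (hx : φ x ≠ x) {D N : Set T.V} (hD : Half (slideGraph T φ n) D x (φ x))
    (hN : Half T.graph N a b) (hne : NE T φ a b) (hm : φ^[n] a = φ^[m] x) (v : T.V)
    (hv : v ∉ N) : v ∈ D ↔ m = 0 := by
  have hN' := hs.ne_half n hN hne
  have hxN : x ∈ N := by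
    rw [← hs.ne_mem_iter m hN hne, ← hm, hs.ne_mem_iter n hN hne]
    exact hN.2.1
  have hxN' : φ x ∈ N := (hs.ne_mem hN hne x).2 hxN
  have h1 := hN'.compl.const (hs.slide_conn n) (fun v => v ∈ D) (by
    intro p q hpq hp hq hpD
    by_contra hqD
    rw [(hD.2.2.2 p q hpq hpD hqD).1] at hp
    exact hp hxN) v hv
  rw [h1]
  have h2 : φ^[n] b ∈ D ↔ φ^[n] a ∈ D := by
    constructor
    · intro hb
      by_contra ha
      have := (hD.2.2.2 _ _ hN'.1.symm hb ha).1
      apply hN'.2.2.1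
      rw [this]; exact hxN
    · intro ha
      by_contra hb
      have := (hD.2.2.2 _ _ hN'.1 ha hb).2
      apply hN'.2.2.1
      rw [this]; exact hxN'
  rw [h2, hm]
  have h3 : ∀ k, φ^[k + 1] x ∉ D := by
    intro k
    induction k with
    | zero => exact hD.2.2.1
    | succ k ih =>
      intro hk
      rw [Function.iterate_succ_apply'] at hk
      have hadj : (slideGraph T φ n).Adj (φ (φ^[k + 1] x)) (φ^[k + 1] x) :=
        ⟨hs.mv_iter _ x hx, Or.inr (Or.inl rfl)⟩
      obtain ⟨e1, e2⟩ := hD.2.2.2 _ _ hadj hk ih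
      rw [e2] at e1
      exact hs.nb x hx e1
  constructor
  · intro hmD
    rcases m with - | m
    · rfl
    · exact absurd hmD (h3 m)
  · rintro rfl
    exact hD.2.1

theorem SAL.case4 {T Y : GTree G} {u : T.V} {t : G} (h : SAL T u t) (hirr : T.Irred)
    (hTY : SameDef T Y)
    (hY : ∀ T' : GTree G, SameDef T T' → ∃ Tt : GTree G, CollapseOf Y Tt ∧ CollapseOf T' Tt) :
    False := by
  obtain ⟨φ, hs, hφ, hφ'⟩ := exists_slideD T u t h.adj h.le
  obtain ⟨w, hw⟩ := exists_NE_edge hirr hs hφ hφ'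
  obtain ⟨N, hN⟩ := exists_half T.isTree hw.1
  obtain ⟨s, hsep⟩ := exists_sep h hs hφ hw hN
  obtain ⟨L, r, hL, hf, hadj, hnb, hr⟩ := fix_ray hTY t u h.hyp h.le
  obtain ⟨j, g, m, hg, hgm, hgm'⟩ := exists_mover hTY h hf hr
  obtain ⟨S, hS⟩ := exists_half Y.isTree (hadj m)
  have hdir := dir Y t (r := fun n => r (n + m)) hL
    (fun n => by rw [show n + 1 + m = n + m + 1 by ring]; exact hadj _)
    (fun n => by rw [show n + 2 + m = n + m + 2 by ring]; exact hnb _)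
    (fun n => by rw [show n + L + m = n + m + L by ring]; exact hr _)
    (S := S) (by
      rw [zero_add, show 1 + m = m + 1 by ring]; exact hS)
  obtain ⟨i1, hi1⟩ := hdir (r 0)
  obtain ⟨i2, hi2⟩ := hdir (Y.act s (r 0))
  obtain ⟨i0, hi01, hi02⟩ : ∃ i0, i1 ≤ i0 ∧ i2 ≤ i0 := ⟨max i1 i2, le_max_left _ _, le_max_right _ _⟩
  let n := i0 + j + 1
  obtain ⟨Tt, ⟨c2, hc2⟩, ⟨c1, hc1⟩⟩ := hY (hs.slide n) (hs.slide_sameDef n)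
  obtain ⟨p0, hp0⟩ := hc2.2.1 (r 0)
  let c1' : Tt.V → T.V := c1
  have c1act : ∀ g v, c1' (Tt.act g v) = T.act g (c1' v) := hc1.1
  have c2act := hc2.1
  obtain ⟨p, hpN, hp⟩ : ∃ p, c1' p ∉ N ∧ ∀ i ≥ i0, Y.act (t ^ i)⁻¹ (c2 p) ∈ S ∧
      Y.act (t ^ i) (c2 p) ∉ S := by
    by_cases hpN : c1' p0 ∈ N
    · refine ⟨Tt.act s p0, ?_, ?_⟩
      · rw [c1act]; exact hsep _ hpN
      · rw [c2act, hp0]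
        exact fun i hi => hi2 i (le_trans hi02 hi)
    · refine ⟨p0, hpN, ?_⟩
      rw [hp0]
      exact fun i hi => hi1 i (le_trans hi01 hi)
  have hx : φ (T.act (t ^ j) u) ≠ T.act (t ^ j) u := (hφ' _).2 ⟨_, rfl⟩
  obtain ⟨D, hD⟩ := exists_half (hs.slide n).isTree
    (a := T.act (t ^ j) u) (b := φ (T.act (t ^ j) u)) ⟨hx.symm, Or.inl rfl⟩
  have hD : Half (slideGraph T φ n) D (T.act (t ^ j) u) (φ (T.act (t ^ j) u)) := hD
  have key : ∀ (z : G) (m : ℕ), T.act (z * t ^ n) u = T.act (t ^ (j + m)) u →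
      (c1' (Tt.act z p) ∈ D ↔ m = 0) := by
    intro z m e
    refine slide_D hs n m hx hD (T.half_translate z hN) (hs.ne_act z hw) ?_ _ ?_
    · rw [iter_u hφ, iter_u hφ, e, pow_add]
    · simp only [Set.mem_setOf_eq]
      rw [c1act, T.act_inv_act]; exact hpN
  obtain ⟨x1, y1, hH1⟩ := half_collapse hc2 hS
  obtain ⟨x2, y2, hH2⟩ := half_collapse hc1 (S := D) hD
  have a1 : c2 (Tt.act (t ^ (i0 + 1))⁻¹ p) ∈ S := by
    rw [c2act]; exact (hp (i0 + 1) (by omega)).1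
  have e1 : (t ^ (i0 + 1))⁻¹ * t ^ n = t ^ j := by
    rw [show n = (i0 + 1) + j by simp only [n]; omega, pow_add]; group
  refine Half.cross Tt.conn hH1 hH2 (x := Tt.act (t ^ (i0 + 1))⁻¹ p) (y := Tt.act (t ^ i0)⁻¹ p)
    (z := Tt.act (g * (t ^ (i0 + 1))⁻¹) p) (w := Tt.act (t ^ i0) p) a1 ?_ ?_ ?_ ?_ ?_ ?_ ?_
  · exact (key _ 0 (by rw [e1]; rfl)).2 rfl
  · change c2 _ ∈ S
    rw [c2act]; exact (hp i0 le_rfl).1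
  · intro hh
    have := (key _ 1 (by
      congr 2
      rw [show n = i0 + (j + 1) by simp only [n]; omega, pow_add t i0]; group)).1 hh
    omega
  · change c2 _ ∉ S
    rw [c2act, Y.act_mul, ← c2act]
    exact Y.moveHalf hS g hgm hgm' _ a1
  · refine (key _ 0 ?_).2 rfl
    rw [mul_assoc, e1, T.act_mul]
    exact hg
  · change c2 _ ∉ S
    rw [c2act]; exact (hp i0 le_rfl).2
  · intro hh
    have := (key _ (2 * i0 + 1) (by
      congr 2
      rw [← pow_add]; congr 1; simp only [n]; omega)).1 hh
    omega

end Case4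


/-- **Proposition (Guirardel–Levitt, Proposition 7.1).** Let `D` be an irreducible
deformation space.  If (1) no reduced tree of `D` has a strict ascending loop, or
(2) some tree of `D` is weakly acylindrical (no nontrivial element fixes an infinite
ray), or (3) no group of `𝒜_min` properly contains a conjugate of itself, or (4) some
`T_c ∈ D` admits a common refinement with every tree of `D`, then `D` is
non-ascending: no tree of `D` has a strict ascending loop. -/
theorem statement_16 {G : Type u} [Group G] [Group.FG G] (T₀ : GTree G)
    (hirr : T₀.Irred) :
    ((∀ T : GTree G, SameDef T₀ T → T.Reduced → ¬HasSAL T) ∨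
      (∃ T : GTree G, SameDef T₀ T ∧ ∀ g : G, g ≠ 1 →
        ¬∃ r : ℕ → T.V, (∀ n : ℕ, T.graph.Adj (r n) (r (n + 1))) ∧
          Function.Injective r ∧ ∀ n : ℕ, T.act g (r n) = r n) ∨
      (∀ H : Subgroup G, Amin T₀ H → ∀ g : G,
        (∀ x ∈ H, g * x * g⁻¹ ∈ H) → ∀ x ∈ H, g⁻¹ * x * g ∈ H) ∨
      (∃ Tc : GTree G, SameDef T₀ Tc ∧ ∀ T : GTree G, SameDef T₀ T →
        ∃ Tt : GTree G, SameDef T₀ Tt ∧ CollapseOf Tc Tt ∧ CollapseOf T Tt)) →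
    ∀ T : GTree G, SameDef T₀ T → ¬HasSAL T := by
  intro hyp T hT hsal
  obtain ⟨u, t, h⟩ := hsal.ex
  rcases hyp with h1 | ⟨Y, hY, h2⟩ | h3 | ⟨Y, hY, h4⟩
  · obtain ⟨F, hF⟩ := exists_cover T
    exact case1_aux T₀ h1 _ T hT F rfl hF hsal
  · exact h.case2 (hT.symm'.trans' hY) h2
  · exact h.case3 (h3 _ (fun Y hY => h.amin Y (hT.symm'.trans' hY)))
  · have hirr' : T.Irred := by
      obtain ⟨a, b, e1, e2, e3⟩ := hirr
      exact ⟨a, b, hyp_same hT _ e1, hyp_same hT _ e2, hyp_same hT _ e3⟩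
    refine h.case4 hirr' (hT.symm'.trans' hY) ?_
    intro T' hT'
    obtain ⟨Tt, -, e1, e2⟩ := h4 T' (hT.trans' hT')
    exact ⟨Tt, e1, e2⟩
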